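/- arXiv:1304.7186 — 3 statements merged into one kernel-verified Lean document; each statement's English description precedes it below -/
import Mathlib

section
/- Let V be a vector configuration in a finite-dimensional real vector space E with dim E ≥ 1, let W = V|S be a subfamily of V, and let T be a set of indices disjoint from S; let U denote the subfamily of the contraction V/W consisting of the images of the vectors v_i with i ∈ T. Assume that disc(V) = disc(W) + disc(V/W), that disc(V/W) = disc((V/W)/U) + disc(U), and that both W and V|(S∪T) are linearly closed in V. Then disc(V|(S∪T)) = disc(U) + disc(W), and consequently disc(V) = disc(V|(S∪T)) + disc(V/(V|(S∪T))). -/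
open scoped Classical

noncomputable section

variable {E : Type*} [AddCommGroup E] [Module ℝ E] {ι : Type*} [Fintype ι]

/-- Number of indices where the functional is positive. -/
def posCount (φ : E →ₗ[ℝ] ℝ) (V : ι → E) : ℕ :=
  (Finset.univ.filter fun i => 0 < φ (V i)).card

/-- Number of indices where the functional is negative. -/
def negCount (φ : E →ₗ[ℝ] ℝ) (V : ι → E) : ℕ :=
  (Finset.univ.filter fun i => φ (V i) < 0).card

/-- Number of indices where the functional is nonpositive. -/
def nonposCount (φ : E →ₗ[ℝ] ℝ) (V : ι → E) : ℕ :=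
  (Finset.univ.filter fun i => φ (V i) ≤ 0).card

/-- Dual codegree: minimum over nonzero functionals of `nonposCount`; by convention the
number of elements when the ambient space is zero-dimensional (trivial). -/
def codegStar (V : ι → E) : ℕ :=
  if Nontrivial E then
    sInf {k | ∃ φ : E →ₗ[ℝ] ℝ, φ ≠ 0 ∧ nonposCount φ V = k}
  else Fintype.card ι

/-- Rank of a configuration: dimension of the linear span. -/
def confRank (V : ι → E) : ℕ :=
  Module.finrank ℝ (Submodule.span ℝ (Set.range V))

/-- Dual degree: maximum over nonzero functionals of `posCount`, minus the rank. -/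
def degStar (V : ι → E) : ℤ :=
  (sSup {k | ∃ φ : E →ₗ[ℝ] ℝ, φ ≠ 0 ∧ posCount φ V = k} : ℕ) - (confRank V : ℤ)

/-- Covector discrepancy: maximum over all functionals of `|φ⁺(V) − φ⁻(V)|`. -/
def disc (V : ι → E) : ℕ :=
  sSup {k | ∃ φ : E →ₗ[ℝ] ℝ, k = ((posCount φ V : ℤ) - (negCount φ V : ℤ)).natAbs}

/-- The subfamily of `V` indexed by `S`. -/
def subfam (V : ι → E) (S : Finset ι) : {i // i ∈ S} → E := fun i => V i.1

/-- The contraction `V/W`, where `W = V|S`: images of the remaining vectors in the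
quotient by the span of `W`. -/
def contract (V : ι → E) (S : Finset ι) :
    {i // i ∉ S} → E ⧸ Submodule.span ℝ (V '' (S : Set ι)) :=
  fun i => Submodule.Quotient.mk (V i.1)

/-- `V|S` is linearly closed in `V`. -/
def LinClosed (V : ι → E) (S : Finset ι) : Prop :=
  ∀ i, V i ∈ Submodule.span ℝ (V '' (S : Set ι)) → i ∈ S

/-- A codegree* decomposition of `V` of length `m`: a partition of the index set into
parts `S 0, S 1, …, S m` with `codegStar (V|S i) ≥ 1` for `i ≠ 0` and
`codegStar V = ∑_{i=1}^m codegStar (V|S i)`. -/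
def IsCodegDecomp (V : ι → E) (m : ℕ) (S : Fin (m + 1) → Finset ι) : Prop :=
  (∀ i j, i ≠ j → Disjoint (S i) (S j)) ∧
  (∀ x, ∃ i, x ∈ S i) ∧
  (∀ i, i ≠ 0 → 1 ≤ codegStar (subfam V (S i))) ∧
  codegStar V = ∑ i ∈ Finset.univ.erase (0 : Fin (m + 1)), codegStar (subfam V (S i))


/-- The subfamily `U` of the contraction `V/(V|S)` consisting of the images of the
vectors `V i` with `i ∈ T`. -/
def contractSub {E : Type*} [AddCommGroup E] [Module ℝ E] {ι : Type*} [Fintype ι]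
    (V : ι → E) (S T : Finset ι) :
    {i // i ∈ T} → E ⧸ Submodule.span ℝ (V '' (S : Set ι)) :=
  fun i => Submodule.Quotient.mk (V i.1)

/-- The iterated contraction `(V/(V|S))/U`, where `U = contractSub V S T`. -/
def contractTwice {E : Type*} [AddCommGroup E] [Module ℝ E] {ι : Type*} [Fintype ι]
    (V : ι → E) (S T : Finset ι) :
    {i // i ∉ S ∧ i ∉ T} →
      (E ⧸ Submodule.span ℝ (V '' (S : Set ι))) ⧸
        Submodule.span ℝ (Set.range (contractSub V S T)) :=
  fun i => Submodule.Quotient.mk (Submodule.Quotient.mk (V i.1))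

open scoped Topology

/-- Signed count of a functional over the indices in `B`. -/
def sgSum {E : Type*} [AddCommGroup E] [Module ℝ E] {ι : Type*}
    (V : ι → E) (φ : E →ₗ[ℝ] ℝ) (B : Finset ι) : ℤ :=
  ∑ i ∈ B, ((SignType.sign (φ (V i)) : SignType) : ℤ)

/-- Attainable absolute signed counts on `B` by functionals vanishing on `P`. -/
def DSet {E : Type*} [AddCommGroup E] [Module ℝ E] {ι : Type*}
    (V : ι → E) (P B : Finset ι) : Set ℕ :=
  {k | ∃ φ : E →ₗ[ℝ] ℝ, (∀ i ∈ P, φ (V i) = 0) ∧ k = (sgSum V φ B).natAbs}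

theorem count_eq {F : Type*} [AddCommGroup F] [Module ℝ F] {κ : Type*} [Fintype κ]
    (φ : F →ₗ[ℝ] ℝ) (V : κ → F) :
    (posCount φ V : ℤ) - (negCount φ V : ℤ) = sgSum V φ Finset.univ := by
  unfold posCount negCount sgSum
  rw [Finset.card_filter, Finset.card_filter]
  push_cast
  rw [← Finset.sum_sub_distrib]
  refine Finset.sum_congr rfl fun i _ => ?_
  rcases lt_trichotomy (φ (V i)) 0 with h | h | h
  · simp [h, not_lt.2 h.le]
  · simp [h]
  · simp [h, not_lt.2 h.le]

theorem sgSum_bound {E : Type*} [AddCommGroup E] [Module ℝ E] {ι : Type*}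
    (V : ι → E) (φ : E →ₗ[ℝ] ℝ) (B : Finset ι) : (sgSum V φ B).natAbs ≤ B.card := by
  zify
  unfold sgSum
  refine (Finset.abs_sum_le_sum_abs _ _).trans ?_
  rw [Finset.card_eq_sum_ones]
  push_cast
  refine Finset.sum_le_sum fun i _ => ?_
  cases SignType.sign (φ (V i)) <;> simp

theorem DSet_bdd {E : Type*} [AddCommGroup E] [Module ℝ E] {ι : Type*}
    (V : ι → E) (P B : Finset ι) : BddAbove (DSet V P B) := by
  refine ⟨B.card, ?_⟩
  rintro k ⟨φ, _, rfl⟩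
  exact sgSum_bound V φ B

theorem sgSum_neg {E : Type*} [AddCommGroup E] [Module ℝ E] {ι : Type*}
    (V : ι → E) (φ : E →ₗ[ℝ] ℝ) (B : Finset ι) : sgSum V (-φ) B = - sgSum V φ B := by
  unfold sgSum
  rw [← Finset.sum_neg_distrib]
  refine Finset.sum_congr rfl fun i _ => ?_
  rw [LinearMap.neg_apply, Left.sign_neg]
  cases SignType.sign (φ (V i)) <;> simp

theorem DSet_attain {E : Type*} [AddCommGroup E] [Module ℝ E] {ι : Type*}
    (V : ι → E) (P B : Finset ι) :
    ∃ φ : E →ₗ[ℝ] ℝ, (∀ i ∈ P, φ (V i) = 0) ∧ sgSum V φ B = ((sSup (DSet V P B) : ℕ) : ℤ) := by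
  have hne : (DSet V P B).Nonempty := ⟨_, 0, by simp, rfl⟩
  obtain ⟨φ, h0, h⟩ := Nat.sSup_mem hne (DSet_bdd V P B)
  rcases Int.natAbs_eq (sgSum V φ B) with h' | h'
  · exact ⟨φ, h0, by rw [h, ← h']⟩
  · refine ⟨-φ, fun i hi => by simp [h0 i hi], ?_⟩
    rw [sgSum_neg, h]
    omega

theorem disc_bridge {E F : Type*} [AddCommGroup E] [Module ℝ E] [AddCommGroup F] [Module ℝ F]
    {ι κ : Type*} [Fintype κ] (V : ι → E) (V' : κ → F) (π : E →ₗ[ℝ] F) (e : κ ↪ ι)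
    (P B : Finset ι) (hB : Finset.univ.map e = B) (hV : ∀ k, V' k = π (V (e k)))
    (hP : ∀ i ∈ P, π (V i) = 0)
    (hl : ∀ φ : E →ₗ[ℝ] ℝ, (∀ i ∈ P, φ (V i) = 0) → ∃ φ' : F →ₗ[ℝ] ℝ, φ'.comp π = φ) :
    disc V' = sSup (DSet V P B) := by
  have key : ∀ φ' : F →ₗ[ℝ] ℝ, sgSum V' φ' Finset.univ = sgSum V (φ'.comp π) B := by
    intro φ'
    subst hB
    unfold sgSum
    rw [Finset.sum_map]
    simp [hV]
  unfold disc
  congr 1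
  ext k
  constructor
  · rintro ⟨φ', rfl⟩
    refine ⟨φ'.comp π, fun i hi => by simp [hP i hi], ?_⟩
    rw [count_eq, key]
  · rintro ⟨φ, h0, rfl⟩
    obtain ⟨φ', rfl⟩ := hl φ h0
    exact ⟨φ', by rw [count_eq, key]⟩

theorem perturb {E : Type*} [AddCommGroup E] [Module ℝ E] {ι : Type*}
    (V : ι → E) (ψ φ : E →ₗ[ℝ] ℝ) (B : Finset ι) :
    ∃ ε : ℝ, ∀ i ∈ B, SignType.sign ((ψ + ε • φ) (V i)) =
      if ψ (V i) = 0 then SignType.sign (φ (V i)) else SignType.sign (ψ (V i)) := by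
  have : ∀ᶠ ε : ℝ in 𝓝[>] 0, ∀ i ∈ B, SignType.sign ((ψ + ε • φ) (V i)) =
      if ψ (V i) = 0 then SignType.sign (φ (V i)) else SignType.sign (ψ (V i)) := by
    rw [Filter.eventually_all_finset]
    intro i _
    by_cases h : ψ (V i) = 0
    · filter_upwards [self_mem_nhdsWithin] with ε hε
      have hε : 0 < ε := hε
      simp [h, sign_mul, sign_pos hε]
    · have hc : Filter.Tendsto (fun ε : ℝ => (ψ + ε • φ) (V i)) (𝓝[>] 0) (𝓝 (ψ (V i))) := by
        have : Continuous (fun ε : ℝ => (ψ + ε • φ) (V i)) := by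
          simp only [LinearMap.add_apply, LinearMap.smul_apply, smul_eq_mul]
          fun_prop
        have h2 := this.tendsto 0
        simp only [zero_smul, add_zero] at h2
        exact h2.mono_left nhdsWithin_le_nhds
      rcases lt_or_gt_of_ne h with h' | h'
      · filter_upwards [hc.eventually_lt_const h'] with ε hε
        rw [if_neg h, sign_neg hε, sign_neg h']
      · filter_upwards [hc.eventually_const_lt h'] with ε hε
        rw [if_neg h, sign_pos hε, sign_pos h']
  exact this.exists

theorem exists_generic {E : Type*} [AddCommGroup E] [Module ℝ E] {ι : Type*}
    (V : ι → E) (A B : Finset ι)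
    (h : ∀ i ∈ B, V i ∉ Submodule.span ℝ (V '' (A : Set ι))) :
    ∃ η : E →ₗ[ℝ] ℝ, (∀ i ∈ A, η (V i) = 0) ∧ ∀ i ∈ B, η (V i) ≠ 0 := by
  induction B using Finset.induction_on with
  | empty => exact ⟨0, by simp, by simp⟩
  | insert j B hj ih =>
    obtain ⟨η, h0, h1⟩ := ih fun i hi => h i (Finset.mem_insert_of_mem hi)
    obtain ⟨ξ, hx, hm⟩ := Submodule.exists_le_ker_of_notMem (h j (Finset.mem_insert_self _ _))
    have hx0 : ∀ i ∈ A, ξ (V i) = 0 := fun i hi =>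
      hm (Submodule.subset_span (Set.mem_image_of_mem V hi))
    obtain ⟨ε, hε⟩ := perturb V η ξ (insert j B)
    refine ⟨η + ε • ξ, fun i hi => by simp [h0 i hi, hx0 i hi], fun i hi => ?_⟩
    rw [← sign_ne_zero, hε i hi]
    split_ifs with hz
    · rcases Finset.mem_insert.1 hi with rfl | hi'
      · exact sign_ne_zero.2 hx
      · exact absurd hz (h1 i hi')
    · exact sign_ne_zero.2 hz

theorem superadd {E : Type*} [AddCommGroup E] [Module ℝ E] {ι : Type*}
    (V : ι → E) (A B : Finset ι) (hAB : Disjoint A B)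
    (h : ∀ i ∈ B, V i ∉ Submodule.span ℝ (V '' (A : Set ι))) :
    sSup (DSet V ∅ A) + sSup (DSet V A B) ≤ sSup (DSet V ∅ (A ∪ B)) := by
  obtain ⟨φ, -, hφ⟩ := DSet_attain V ∅ A
  obtain ⟨ψ, hψ0, hψ⟩ := DSet_attain V A B
  obtain ⟨η, hη0, hη⟩ := exists_generic V A B h
  -- a generic functional that is at least as good
  obtain ⟨χ, hχ0, hχ, hχs⟩ : ∃ χ : E →ₗ[ℝ] ℝ, (∀ i ∈ A, χ (V i) = 0) ∧
      (∀ i ∈ B, χ (V i) ≠ 0) ∧ ((sSup (DSet V A B) : ℕ) : ℤ) ≤ sgSum V χ B := by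
    obtain ⟨ε, hε⟩ := perturb V ψ η B
    obtain ⟨δ, hδ⟩ := perturb V ψ (-η) B
    have hsum : sgSum V (ψ + ε • η) B + sgSum V (ψ + δ • (-η)) B = 2 * sgSum V ψ B := by
      unfold sgSum
      rw [← Finset.sum_add_distrib, Finset.mul_sum]
      refine Finset.sum_congr rfl fun i hi => ?_
      rw [hε i hi, hδ i hi]
      split_ifs with hz
      · rw [hz, LinearMap.neg_apply, Left.sign_neg]
        cases SignType.sign (η (V i)) <;> simp
      · ring
    have n1 : ∀ i ∈ B, (ψ + ε • η) (V i) ≠ 0 := fun i hi => by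
      rw [← sign_ne_zero, hε i hi]
      split_ifs with hz
      · exact sign_ne_zero.2 (hη i hi)
      · exact sign_ne_zero.2 hz
    have n2 : ∀ i ∈ B, (ψ + δ • (-η)) (V i) ≠ 0 := fun i hi => by
      rw [← sign_ne_zero, hδ i hi]
      split_ifs with hz
      · exact sign_ne_zero.2 (by simpa using hη i hi)
      · exact sign_ne_zero.2 hz
    by_cases hc : ((sSup (DSet V A B) : ℕ) : ℤ) ≤ sgSum V (ψ + ε • η) B
    · exact ⟨_, fun i hi => by simp [hψ0 i hi, hη0 i hi], n1, hc⟩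
    · exact ⟨_, fun i hi => by simp [hψ0 i hi, hη0 i hi], n2, by omega⟩
  obtain ⟨ε, hε⟩ := perturb V χ φ (A ∪ B)
  have h1 : sgSum V (χ + ε • φ) (A ∪ B) = sgSum V φ A + sgSum V χ B := by
    unfold sgSum
    rw [Finset.sum_union hAB]
    congr 1
    · refine Finset.sum_congr rfl fun i hi => ?_
      rw [hε i (Finset.mem_union_left _ hi), if_pos (hχ0 i hi)]
    · refine Finset.sum_congr rfl fun i hi => ?_
      rw [hε i (Finset.mem_union_right _ hi), if_neg (hχ i hi)]
  have h2 : (sgSum V (χ + ε • φ) (A ∪ B)).natAbs ≤ sSup (DSet V ∅ (A ∪ B)) :=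
    le_csSup (DSet_bdd _ _ _) ⟨_, by simp, rfl⟩
  omega

theorem quot_zero {E : Type*} [AddCommGroup E] [Module ℝ E] {ι : Type*}
    (V : ι → E) (A : Finset ι) (i : ι) (hi : i ∈ A) :
    (Submodule.span ℝ (V '' (A : Set ι))).mkQ (V i) = 0 := by
  rw [Submodule.mkQ_apply, Submodule.Quotient.mk_eq_zero]
  exact Submodule.subset_span (Set.mem_image_of_mem V hi)

theorem quot_lift {E : Type*} [AddCommGroup E] [Module ℝ E] {ι : Type*}
    (V : ι → E) (A : Finset ι) (φ : E →ₗ[ℝ] ℝ) (h : ∀ i ∈ A, φ (V i) = 0) :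
    ∃ φ' : (E ⧸ Submodule.span ℝ (V '' (A : Set ι))) →ₗ[ℝ] ℝ,
      φ'.comp (Submodule.span ℝ (V '' (A : Set ι))).mkQ = φ := by
  refine ⟨Submodule.liftQ _ φ ?_, Submodule.liftQ_mkQ _ _ _⟩
  rw [Submodule.span_le]
  rintro _ ⟨i, hi, rfl⟩
  exact h i hi

theorem disc_iterative_extremal {E : Type*} [AddCommGroup E] [Module ℝ E]
    [FiniteDimensional ℝ E] (hE : 1 ≤ Module.finrank ℝ E)
    {ι : Type*} [Fintype ι] (V : ι → E) (S T : Finset ι) (hST : Disjoint S T)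
    (hSclosed : LinClosed V S) (hSTclosed : LinClosed V (S ∪ T))
    (h1 : disc V = disc (subfam V S) + disc (contract V S))
    (h2 : disc (contract V S) = disc (contractTwice V S T) + disc (contractSub V S T)) :
    disc (subfam V (S ∪ T)) = disc (contractSub V S T) + disc (subfam V S) ∧
    disc V = disc (subfam V (S ∪ T)) + disc (contract V (S ∪ T)) := by
  have eV : disc V = sSup (DSet V ∅ Finset.univ) :=
    disc_bridge V V LinearMap.id (Function.Embedding.refl ι) ∅ _ (by simp) (fun _ => rfl)
      (by simp) (fun φ _ => ⟨φ, rfl⟩)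
  have eSub : ∀ A : Finset ι, disc (subfam V A) = sSup (DSet V ∅ A) := fun A =>
    disc_bridge V (subfam V A) LinearMap.id (Function.Embedding.subtype _) ∅ A
      (by ext; simp) (fun _ => rfl) (by simp) (fun φ _ => ⟨φ, rfl⟩)
  have eCon : ∀ A : Finset ι, disc (contract V A) = sSup (DSet V A Aᶜ) := fun A =>
    disc_bridge V (contract V A) (Submodule.mkQ _) (Function.Embedding.subtype _) A Aᶜ
      (by ext; simp) (fun _ => rfl) (quot_zero V A) (quot_lift V A)
  have eCS : disc (contractSub V S T) = sSup (DSet V S T) :=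
    disc_bridge V (contractSub V S T) (Submodule.mkQ _) (Function.Embedding.subtype _) S T
      (by ext; simp) (fun _ => rfl) (quot_zero V S) (quot_lift V S)
  have eCT : disc (contractTwice V S T) = sSup (DSet V (S ∪ T) (S ∪ T)ᶜ) := by
    refine disc_bridge V (contractTwice V S T)
      ((Submodule.mkQ (Submodule.span ℝ (Set.range (contractSub V S T)))).comp (Submodule.mkQ _))
      (Function.Embedding.subtype _) (S ∪ T) (S ∪ T)ᶜ
      (by ext; simp) (fun _ => rfl) ?_ ?_
    · intro i hi
      rw [LinearMap.comp_apply]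
      rcases Finset.mem_union.1 hi with hi | hi
      · rw [quot_zero V S i hi, map_zero]
      · rw [Submodule.mkQ_apply, Submodule.Quotient.mk_eq_zero]
        exact Submodule.subset_span ⟨⟨i, hi⟩, rfl⟩
    · intro φ h
      obtain ⟨φ', hφ'⟩ := quot_lift V S φ fun i hi => h i (Finset.mem_union_left _ hi)
      refine ⟨Submodule.liftQ _ φ' ?_, ?_⟩
      · rw [Submodule.span_le]
        rintro _ ⟨i, rfl⟩
        have := h i.1 (Finset.mem_union_right _ i.2)
        rw [← hφ'] at this
        exact this
      · rw [← LinearMap.comp_assoc, Submodule.liftQ_mkQ, hφ']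
  have s1 := superadd V S T hST fun i hi hm =>
    Finset.disjoint_left.1 hST (hSclosed i hm) hi
  have s2 := superadd V (S ∪ T) (S ∪ T)ᶜ disjoint_compl_right fun i hi hm =>
    Finset.mem_compl.1 hi (hSTclosed i hm)
  have hu : (S ∪ T) ∪ (S ∪ T)ᶜ = Finset.univ := Finset.union_compl _
  rw [hu] at s2
  rw [eCT, eCS] at h2
  rw [h2, eV, eSub] at h1
  rw [eV, eSub, eSub, eCS, eCon]
  omega

end
end

section
/- Let V be an irreducible vector configuration of rank r in a finite-dimensional real vector space E with dim E ≥ 1, and suppose disc(V) > 0. Then V admits a codegree* decomposition of length m for some natural number m with m ≥ r + 1 − 2·disc(V) (an inequality of integers). -/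
open scoped Classical

noncomputable section

variable {E : Type*} [AddCommGroup E] [Module ℝ E] {ι : Type*} [Fintype ι]

section SylvesterGallai

set_option linter.unusedSectionVars false

universe u w

variable {U : Type u} [AddCommGroup U] [Module ℝ U] [FiniteDimensional ℝ U] {κ : Type w}

/-- Span of the subfamily indexed by `S`. -/
def sgSp (f : κ → U) (S : Finset κ) : Submodule ℝ U := Submodule.span ℝ (f '' (S : Set κ))

/-- Rank of the subfamily indexed by `S`. -/
def sgRk (f : κ → U) (S : Finset κ) : ℕ := Module.finrank ℝ (sgSp f S)

lemma sgSp_mem {f : κ → U} {S : Finset κ} {i : κ} (h : i ∈ S) : f i ∈ sgSp f S :=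
  Submodule.subset_span ⟨i, h, rfl⟩

lemma sgSp_le {f : κ → U} {S : Finset κ} {p : Submodule ℝ U} (h : ∀ i ∈ S, f i ∈ p) :
    sgSp f S ≤ p := by
  refine Submodule.span_le.2 ?_
  rintro _ ⟨i, hi, rfl⟩
  exact h i hi

lemma sgSp_mono {f : κ → U} {A B : Finset κ} (h : A ⊆ B) : sgSp f A ≤ sgSp f B :=
  sgSp_le fun _ hi => sgSp_mem (h hi)

lemma sgSp_union {f : κ → U} {A B : Finset κ} : sgSp f (A ∪ B) = sgSp f A ⊔ sgSp f B := by
  simp [sgSp, Set.image_union, Submodule.span_union]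

lemma sgSp_insert {f : κ → U} {A : Finset κ} {e : κ} :
    sgSp f (insert e A) = Submodule.span ℝ {f e} ⊔ sgSp f A := by
  simp [sgSp, Set.image_insert_eq, Submodule.span_insert]

lemma sgRk_mono {f : κ → U} {A B : Finset κ} (h : A ⊆ B) : sgRk f A ≤ sgRk f B :=
  Submodule.finrank_mono (sgSp_mono h)

lemma sgRk_union_inter {f : κ → U} {A B : Finset κ} :
    sgRk f (A ∪ B) + sgRk f (A ∩ B) ≤ sgRk f A + sgRk f B := by
  have h := Submodule.finrank_sup_add_finrank_inf_eq (sgSp f A) (sgSp f B)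
  have h2 : sgSp f (A ∩ B) ≤ sgSp f A ⊓ sgSp f B :=
    le_inf (sgSp_mono Finset.inter_subset_left) (sgSp_mono Finset.inter_subset_right)
  have h3 := Submodule.finrank_mono h2
  unfold sgRk
  rw [sgSp_union]
  omega

lemma sgRk_union_le {f : κ → U} {A B : Finset κ} :
    sgRk f (A ∪ B) ≤ sgRk f A + sgRk f B := by
  have := sgRk_union_inter (f := f) (A := A) (B := B)
  omega

lemma sgRk_le_card {f : κ → U} {A : Finset κ} : sgRk f A ≤ A.card := by
  have h := finrank_span_finset_le_card (R := ℝ) (A.image f)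
  simp only [sgRk, sgSp]
  rw [Finset.coe_image] at h
  exact h.trans Finset.card_image_le

lemma sgRk_empty {f : κ → U} : sgRk f ∅ = 0 := by
  have := sgRk_le_card (f := f) (A := ∅)
  simpa using this

lemma sgRk_insert_le {f : κ → U} {A : Finset κ} {e : κ} :
    sgRk f (insert e A) ≤ sgRk f A + 1 := by
  have h : sgRk f ({e} ∪ A) ≤ _ := sgRk_union_le
  have h2 : sgRk f {e} ≤ 1 := by simpa using sgRk_le_card (f := f) (A := {e})
  rw [Finset.insert_eq]
  omega

lemma sgRk_insert_eq {f : κ → U} {A : Finset κ} {e : κ} (h : f e ∈ sgSp f A) :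
    sgRk f (insert e A) = sgRk f A := by
  have : sgSp f (insert e A) = sgSp f A := by
    rw [sgSp_insert, sup_eq_right]
    exact (Submodule.span_singleton_le_iff_mem _ _).2 h
  unfold sgRk
  rw [this]

lemma sgRk_insert_lt {f : κ → U} {A : Finset κ} {e : κ} (h : f e ∉ sgSp f A) :
    sgRk f (insert e A) = sgRk f A + 1 := by
  refine le_antisymm sgRk_insert_le ?_
  refine Submodule.finrank_lt_finrank_of_lt (lt_of_le_of_ne (sgSp_mono (Finset.subset_insert _ _)) ?_)
  intro h2
  exact h (h2 ▸ sgSp_mem (Finset.mem_insert_self _ _))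

/-- Admissible functionals: kernels are hyperplanes spanned by the configuration. -/
def sgAdm (f : κ → U) (S : Finset κ) (q : U →ₗ[ℝ] ℝ) : Prop :=
  sgRk f (S.filter fun i => q (f i) = 0) + 1 = sgRk f S

lemma sgSp_le_ker {f : κ → U} {A : Finset κ} {q : U →ₗ[ℝ] ℝ} (h : ∀ i ∈ A, q (f i) = 0) :
    sgSp f A ≤ LinearMap.ker q := sgSp_le fun i hi => by simpa using h i hi

lemma sgAdm_of {f : κ → U} {S A : Finset κ} {q : U →ₗ[ℝ] ℝ} (hA : A ⊆ S)
    (h0 : ∀ i ∈ A, q (f i) = 0) (hr : sgRk f S ≤ sgRk f A + 1) {s : κ} (hs : s ∈ S)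
    (hq : q (f s) ≠ 0) : sgAdm f S q := by
  have h1 : sgRk f A ≤ sgRk f (S.filter fun i => q (f i) = 0) :=
    sgRk_mono fun i hi => by simp [hA hi, h0 i hi]
  have h2 : sgRk f (S.filter fun i => q (f i) = 0) < sgRk f S := by
    refine Submodule.finrank_lt_finrank_of_lt
      (lt_of_le_of_ne (sgSp_mono (Finset.filter_subset _ _)) ?_)
    intro h
    have h3 : f s ∈ sgSp f (S.filter fun i => q (f i) = 0) := h ▸ sgSp_mem hs
    exact hq (sgSp_le_ker (by simp) h3)
  unfold sgAdm
  omega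

lemma sgAdm_exists {f : κ → U} {S : Finset κ} {q : U →ₗ[ℝ] ℝ} (h : sgAdm f S q) :
    ∃ s ∈ S, q (f s) ≠ 0 := by
  by_contra! h2
  unfold sgAdm at h
  rw [Finset.filter_true_of_mem h2] at h
  omega

lemma sgAdm_neg {f : κ → U} {S : Finset κ} {q : U →ₗ[ℝ] ℝ} (h : sgAdm f S q) :
    sgAdm f S (-q) := by
  simpa [sgAdm] using h

lemma sgAdm_smul {f : κ → U} {S : Finset κ} {q : U →ₗ[ℝ] ℝ} (h : sgAdm f S q) {c : ℝ}
    (hc : c ≠ 0) : sgAdm f S (c • q) := by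
  simpa [sgAdm, hc] using h

lemma sgAdm_ker {f : κ → U} {S : Finset κ} {q : U →ₗ[ℝ] ℝ} (h : sgAdm f S q) {x : U}
    (hx : x ∈ sgSp f S) (hq : q x = 0) : x ∈ sgSp f (S.filter fun i => q (f i) = 0) := by
  obtain ⟨s, hs, hs0⟩ := sgAdm_exists h
  have h1 : sgSp f (S.filter fun i => q (f i) = 0) ≤ sgSp f S ⊓ LinearMap.ker q :=
    le_inf (sgSp_mono (Finset.filter_subset _ _)) (sgSp_le_ker (by simp))
  have h2 : sgSp f S ⊓ LinearMap.ker q < sgSp f S := by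
    refine lt_of_le_of_ne inf_le_left fun h3 => hs0 ?_
    have : f s ∈ sgSp f S ⊓ LinearMap.ker q := by rw [h3]; exact sgSp_mem hs
    exact this.2
  have h3 := Submodule.finrank_lt_finrank_of_lt h2
  have h4 : sgSp f (S.filter fun i => q (f i) = 0) = sgSp f S ⊓ LinearMap.ker q := by
    apply Submodule.eq_of_le_of_finrank_le h1
    unfold sgAdm sgRk at h
    omega
  rw [h4]
  exact ⟨hx, hq⟩

lemma sgAdm_of_rk {f : κ → U} {S A : Finset κ} (hA : A ⊆ S) (hr : sgRk f A + 1 = sgRk f S) :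
    ∃ q, sgAdm f S q ∧ ∀ i ∈ A, q (f i) = 0 := by
  have : ∃ s ∈ S, f s ∉ sgSp f A := by
    by_contra! h
    have := Submodule.finrank_mono (sgSp_le h)
    unfold sgRk at hr
    omega
  obtain ⟨s, hs, hsA⟩ := this
  obtain ⟨q, hq, hk⟩ := Submodule.exists_le_ker_of_notMem hsA
  have h0 : ∀ i ∈ A, q (f i) = 0 := fun i hi => hk (sgSp_mem hi)
  exact ⟨q, sgAdm_of hA h0 hr.ge hs hq, h0⟩

/-- Generic points of the span. -/
def sgGen (f : κ → U) (S : Finset κ) (l : U) : Prop :=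
  l ∈ sgSp f S ∧ ∀ q, sgAdm f S q → q l ≠ 0

/-- Closed cell of `l`. -/
def sgCell (f : κ → U) (S : Finset κ) (l : U) : Set U :=
  {x | x ∈ sgSp f S ∧ ∀ q, sgAdm f S q → 0 < q l → 0 ≤ q x}

/-- Separable configurations. -/
def sgSep (f : κ → U) (S : Finset κ) : Prop :=
  ∃ A B : Finset κ, A.Nonempty ∧ B.Nonempty ∧ Disjoint A B ∧ A ∪ B = S ∧
    sgRk f A + sgRk f B ≤ sgRk f S

lemma sgCell_sign {f : κ → U} {S : Finset κ} {l : U} (hl : sgGen f S l) {q : U →ₗ[ℝ] ℝ}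
    (hq : sgAdm f S q) {x y : U} (hx : x ∈ sgCell f S l) (hy : y ∈ sgCell f S l) :
    0 ≤ q x * q y := by
  rcases lt_or_gt_of_ne (hl.2 q hq) with h | h
  · have h1 := hx.2 (-q) (sgAdm_neg hq) (by simpa using h)
    have h2 := hy.2 (-q) (sgAdm_neg hq) (by simpa using h)
    simp only [LinearMap.neg_apply] at h1 h2
    nlinarith
  · exact mul_nonneg (hx.2 q hq h) (hy.2 q hq h)

lemma sgCell_smul {f : κ → U} {S : Finset κ} {l x : U} (hx : x ∈ sgCell f S l) {c : ℝ}
    (hc : 0 ≤ c) : c • x ∈ sgCell f S l :=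
  ⟨Submodule.smul_mem _ _ hx.1, fun q hq h => by
    simpa using mul_nonneg hc (hx.2 q hq h)⟩

/-- Rank in the contraction by `e`. -/
lemma sgRk_contract {f : κ → U} {A : Finset κ} {e : κ} (he : f e ≠ 0) :
    sgRk (fun i => (Submodule.span ℝ {f e}).mkQ (f i)) A + 1 = sgRk f (insert e A) := by
  have h1 : sgSp (fun i => (Submodule.span ℝ {f e}).mkQ (f i)) A
      = (sgSp f (insert e A)).map (Submodule.span ℝ {f e}).mkQ := by
    rw [sgSp_insert, Submodule.map_sup]
    have : Submodule.map (Submodule.span ℝ {f e}).mkQ (Submodule.span ℝ {f e}) = ⊥ :=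
      Submodule.mkQ_map_self _
    rw [this, bot_sup_eq, sgSp, sgSp, Submodule.map_span, Set.image_image]
  have h2 := LinearMap.finrank_range_add_finrank_ker
    ((Submodule.span ℝ {f e}).mkQ.domRestrict (sgSp f (insert e A)))
  have h3 : LinearMap.range ((Submodule.span ℝ {f e}).mkQ.domRestrict (sgSp f (insert e A)))
      = (sgSp f (insert e A)).map (Submodule.span ℝ {f e}).mkQ := by
    rw [LinearMap.range_domRestrict]
  have h4 : LinearMap.ker ((Submodule.span ℝ {f e}).mkQ.domRestrict (sgSp f (insert e A)))
      = (Submodule.span ℝ {f e}).comap (sgSp f (insert e A)).subtype := by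
    ext x
    simp [LinearMap.mem_ker]
  have h5 : Module.finrank ℝ ((Submodule.span ℝ {f e}).comap (sgSp f (insert e A)).subtype) = 1 := by
    rw [(Submodule.comapSubtypeEquivOfLe (p := Submodule.span ℝ {f e})
      (q := sgSp f (insert e A)) (by rw [sgSp_insert]; exact le_sup_left)).finrank_eq]
    exact finrank_span_singleton he
  rw [h3, h4, h5, ← h1] at h2
  exact h2

lemma sgSep_tutte {f : κ → U} {S : Finset κ} {e : κ} (he : e ∈ S) (hf : f e ≠ 0)
    (hrk : sgRk f (S.erase e) = sgRk f S) (h1 : sgSep f (S.erase e))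
    (h2 : sgSep (fun i => (Submodule.span ℝ {f e}).mkQ (f i)) (S.erase e)) : sgSep f S := by
  obtain ⟨A, B, hA, hB, hAB, hABS, hr1⟩ := h1
  obtain ⟨C, D, hC, hD, hCD, hCDS, hr2⟩ := h2
  have c1 := sgRk_contract (A := C) hf
  have c2 := sgRk_contract (A := D) hf
  have c3 := sgRk_contract (A := S.erase e) hf
  rw [Finset.insert_erase he] at c3
  have heA : e ∉ A := fun h => by
    have : e ∈ S.erase e := hABS ▸ Finset.mem_union_left _ h
    simp at this
  have heB : e ∉ B := fun h => by
    have : e ∈ S.erase e := hABS ▸ Finset.mem_union_right _ h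
    simp at this
  -- general step
  have key : ∀ A B C D : Finset κ, Disjoint A B → A ∪ B = S.erase e → Disjoint C D →
      C ∪ D = S.erase e → e ∉ A → e ∉ B →
      (B ∩ D).Nonempty → sgRk f (A ∪ insert e C) + sgRk f (B ∩ D) ≤ sgRk f S → sgSep f S := by
    intro A B C D hAB hABS hCD hCDS heA heB hne hle
    refine ⟨A ∪ insert e C, B ∩ D, ⟨e, by simp⟩, hne, ?_, ?_, hle⟩
    · rw [Finset.disjoint_left] at hAB hCD ⊢
      intro x hx hx2
      simp only [Finset.mem_union, Finset.mem_insert, Finset.mem_inter] at hx hx2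
      rcases hx with h | h | h
      · exact hAB h hx2.1
      · exact heB (h ▸ hx2.1)
      · exact hCD h hx2.2
    · ext x
      have e1 := congrArg (x ∈ ·) hABS
      have e2 := congrArg (x ∈ ·) hCDS
      simp only [Finset.mem_union, Finset.mem_insert, Finset.mem_inter, Finset.mem_erase,
        eq_iff_iff] at e1 e2 ⊢
      by_cases hx : x = e
      · subst hx; simp [he]
      · tauto
  have sub : ∀ A C : Finset κ, e ∉ A → sgRk f (A ∪ insert e C) + sgRk f (A ∩ C) ≤
      sgRk f A + sgRk f (insert e C) := by
    intro A C heA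
    have := sgRk_union_inter (f := f) (A := A) (B := insert e C)
    rwa [Finset.inter_insert_of_notMem heA] at this
  have s1 := sub A C heA
  have s2 := sub B D heB
  have s3 := sub A D heA
  have s4 := sub B C heB
  have hBA := hAB.symm
  have hDC := hCD.symm
  have hBAS : B ∪ A = S.erase e := by rw [Finset.union_comm]; exact hABS
  have hDCS : D ∪ C = S.erase e := by rw [Finset.union_comm]; exact hCDS
  by_contra hno
  have k1 := fun h => mt (key A B C D hAB hABS hCD hCDS heA heB h) hno
  have k2 := fun h => mt (key B A D C hBA hBAS hDC hDCS heB heA h) hno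
  have k3 := fun h => mt (key A B D C hAB hABS hDC hDCS heA heB h) hno
  have k4 := fun h => mt (key B A C D hBA hBAS hCD hCDS heB heA h) hno
  have split : ∀ X : Finset κ, X.Nonempty → ∀ P Q : Finset κ, P ∪ Q = S.erase e →
      X ⊆ S.erase e → (X ∩ P).Nonempty ∨ (X ∩ Q).Nonempty := by
    intro X ⟨x, hx⟩ P Q hPQ hX
    have := hX hx
    rw [← hPQ, Finset.mem_union] at this
    rcases this with h | h
    · exact Or.inl ⟨x, by simp [hx, h]⟩
    · exact Or.inr ⟨x, by simp [hx, h]⟩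
  have t1 := split A hA C D hCDS (hABS ▸ Finset.subset_union_left)
  have t2 := split B hB C D hCDS (hABS ▸ Finset.subset_union_right)
  have t3 := split C hC A B hABS (hCDS ▸ Finset.subset_union_left)
  have t4 := split D hD A B hABS (hCDS ▸ Finset.subset_union_right)
  rw [Finset.inter_comm C A, Finset.inter_comm C B] at t3
  rw [Finset.inter_comm D A, Finset.inter_comm D B] at t4
  by_cases g1 : (B ∩ D).Nonempty <;> by_cases g2 : (A ∩ C).Nonempty <;>
    by_cases g3 : (B ∩ C).Nonempty <;> by_cases g4 : (A ∩ D).Nonempty <;>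
    simp only [g1, g2, g3, g4, forall_true_left, not_le, or_self, or_true,
      or_false, IsEmpty.forall_iff] at k1 k2 k3 k4 t1 t2 t3 t4 <;> omega

lemma sg_dual {f : κ → U} {B : Finset κ} (h : LinearIndepOn ℝ f (B : Set κ)) (c : κ → ℝ) :
    ∃ φ : U →ₗ[ℝ] ℝ, ∀ b ∈ B, φ (f b) = c b := by
  let b := Module.Basis.span h
  obtain ⟨g, hg⟩ := LinearMap.exists_extend (b.constr ℝ (fun i : (B : Set κ) => c i))
  refine ⟨g, fun i hi => ?_⟩
  have h1 := LinearMap.congr_fun hg (b ⟨i, hi⟩)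
  rw [Module.Basis.constr_basis] at h1
  have h2 : ((b ⟨i, hi⟩ : _) : U) = f i :=
    congrArg Subtype.val (Module.Basis.span_apply h ⟨i, hi⟩)
  simpa [h2] using h1



lemma sgAdm_contract {f : κ → U} {S : Finset κ} {e : κ} (he : e ∈ S) (hf : f e ≠ 0)
    {q : (U ⧸ Submodule.span ℝ {f e}) →ₗ[ℝ] ℝ}
    (hq : sgAdm (fun i => (Submodule.span ℝ {f e}).mkQ (f i)) (S.erase e) q) :
    sgAdm f S (q.comp (Submodule.span ℝ {f e}).mkQ) := by
  obtain ⟨s, hs, hs0⟩ := sgAdm_exists hq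
  have hq' : sgRk (fun i => (Submodule.span ℝ {f e}).mkQ (f i)) ((S.erase e).filter
      fun i => q ((Submodule.span ℝ {f e}).mkQ (f i)) = 0) + 1 =
      sgRk (fun i => (Submodule.span ℝ {f e}).mkQ (f i)) (S.erase e) := hq
  have c1 := sgRk_contract (f := f) (e := e) (A := (S.erase e).filter
    fun i => q ((Submodule.span ℝ {f e}).mkQ (f i)) = 0) hf
  have c2 := sgRk_contract (A := S.erase e) hf
  rw [Finset.insert_erase he] at c2
  refine sgAdm_of (A := insert e ((S.erase e).filter
    fun i => q ((Submodule.span ℝ {f e}).mkQ (f i)) = 0)) (s := s) ?_ ?_ ?_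
    (Finset.mem_of_mem_erase hs) hs0
  · intro x hx
    simp only [Finset.mem_insert, Finset.mem_filter, Finset.mem_erase] at hx
    rcases hx with rfl | hx
    · exact he
    · exact hx.1.2
  · intro i hi
    rcases Finset.mem_insert.1 hi with rfl | hx
    · have : (Submodule.span ℝ {f i}).mkQ (f i) = 0 := by
        rw [← LinearMap.mem_ker, Submodule.ker_mkQ]
        exact Submodule.mem_span_singleton_self _
      simp only [LinearMap.comp_apply, this, map_zero]
    · exact (Finset.mem_filter.1 hx).2
  · omega

lemma sgSp_contract {f : κ → U} {S : Finset κ} {e : κ} {x : U} (hx : x ∈ sgSp f S) :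
    (Submodule.span ℝ {f e}).mkQ x ∈
      sgSp (fun i => (Submodule.span ℝ {f e}).mkQ (f i)) (S.erase e) := by
  have : sgSp f S ≤ (sgSp (fun i => (Submodule.span ℝ {f e}).mkQ (f i)) (S.erase e)).comap
      (Submodule.span ℝ {f e}).mkQ := by
    refine sgSp_le fun i hi => ?_
    rw [Submodule.mem_comap]
    by_cases h : i = e
    · subst h
      have : (Submodule.span ℝ {f i}).mkQ (f i) = 0 := by
        rw [← LinearMap.mem_ker, Submodule.ker_mkQ]
        exact Submodule.mem_span_singleton_self _
      rw [this]
      exact zero_mem _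
    · exact sgSp_mem (f := fun i => (Submodule.span ℝ {f e}).mkQ (f i))
        (Finset.mem_erase.2 ⟨h, hi⟩)
  exact this hx

lemma sgAdm_erase {f : κ → U} {S : Finset κ} {e : κ}
    (hrk : sgRk f (S.erase e) = sgRk f S) {q : U →ₗ[ℝ] ℝ} (hq : sgAdm f (S.erase e) q) :
    sgAdm f S q := by
  obtain ⟨s, hs, hs0⟩ := sgAdm_exists hq
  unfold sgAdm at hq
  refine sgAdm_of (A := (S.erase e).filter fun i => q (f i) = 0) (s := s) ?_ ?_ ?_
    (Finset.mem_of_mem_erase hs) hs0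
  · exact (Finset.filter_subset _ _).trans (Finset.erase_subset _ _)
  · intro i hi
    exact (Finset.mem_filter.1 hi).2
  · omega

/-- A spanning independent subfamily. -/
lemma sg_basis (f : κ → U) (S : Finset κ) : ∃ B ⊆ S, LinearIndepOn ℝ f (B : Set κ) ∧
    sgSp f B = sgSp f S ∧ sgRk f B = B.card := by
  obtain ⟨b, hb, -, hsp, hli⟩ := exists_linearIndepOn_extension (K := ℝ) (v := f) (s := ∅)
    (t := (S : Set κ)) (linearIndepOn_empty _ _) (Set.empty_subset _)
  have hfin : b.Finite := S.finite_toSet.subset hb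
  lift b to Finset κ using hfin
  refine ⟨b, by simpa using hb, hli, ?_, ?_⟩
  · exact le_antisymm (sgSp_mono (by simpa using hb)) (Submodule.span_le.2 hsp)
  · have h := finrank_span_eq_card (R := ℝ) (b := fun i : b => f i) hli
    have h2 : Set.range (fun i : b => f i) = f '' (b : Set κ) := by
      ext; simp
    rw [h2] at h
    exact h.trans (Fintype.card_coe b)

lemma sg_key_indep {f : κ → U} {S : Finset κ} {l : U}
    (hl : sgGen f S l) (h0 : ∀ e ∈ S, f e ≠ 0)
    (hcol : ∀ e ∈ S, sgRk f (S.erase e) = sgRk f S)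
    (hpar : ∀ e ∈ S, ∀ e' ∈ S, e ≠ e' → f e ∉ Submodule.span ℝ {f e'})
    (hD : ∀ e ∈ S, f e ∈ sgCell f S l ∨ -f e ∈ sgCell f S l) : S = ∅ := by
  by_contra hne
  obtain ⟨s0, hs0⟩ := Finset.nonempty_iff_ne_empty.2 hne
  obtain ⟨B, hBS, hli, hsp, hcard⟩ := sg_basis f S
  have hrkB : sgRk f B = sgRk f S := by unfold sgRk; rw [hsp]
  have hBne : ∃ e ∈ S, e ∉ B := by
    by_contra! h
    have h1 := hcol s0 hs0
    have h2 := sgRk_le_card (f := f) (A := S.erase s0)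
    rw [Finset.card_erase_of_mem hs0] at h2
    have h3 : S = B := Finset.Subset.antisymm h hBS
    have h4 : 0 < S.card := Finset.card_pos.2 ⟨s0, hs0⟩
    rw [← h3] at hcard
    omega
  obtain ⟨e, he, heB⟩ := hBne
  have hch : ∀ b : κ, ∃ φ : U →ₗ[ℝ] ℝ, ∀ b' ∈ B, φ (f b') = if b' = b then 1 else 0 :=
    fun b => sg_dual hli _
  choose φ hφ using hch
  have heq : ∀ x ∈ sgSp f S, x = ∑ b ∈ B, φ b x • f b := by
    intro x hx
    have : sgSp f S ≤ LinearMap.eqLocus LinearMap.id (∑ b ∈ B, (φ b).smulRight (f b)) := by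
      rw [← hsp]
      refine sgSp_le fun i hi => ?_
      rw [LinearMap.mem_eqLocus]
      simp only [LinearMap.id_apply, LinearMap.sum_apply, LinearMap.smulRight_apply]
      rw [Finset.sum_eq_single i]
      · simp [hφ i i hi]
      · intro b hb hbi
        simp [hφ b i hi, hbi.symm]
      · exact fun h => absurd hi h
    have h2 := this hx
    rw [LinearMap.mem_eqLocus] at h2
    simpa using h2
  have hfe := heq (f e) (sgSp_mem he)
  -- two nonzero coefficients
  have h1 : ∃ b ∈ B, φ b (f e) ≠ 0 := by
    by_contra! h
    rw [Finset.sum_eq_zero (fun b hb => by simp [h b hb])] at hfe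
    exact h0 e he hfe
  obtain ⟨b, hb, hcb⟩ := h1
  have h2 : ∃ b' ∈ B, b' ≠ b ∧ φ b' (f e) ≠ 0 := by
    by_contra! h
    rw [Finset.sum_eq_single b (fun b' hb' hne => by simp [h b' hb' hne])
      (fun h => absurd hb h)] at hfe
    refine hpar e he b (hBS hb) (fun h => heB (h ▸ hb)) ?_
    rw [hfe]
    exact Submodule.smul_mem _ _ (Submodule.mem_span_singleton_self _)
  obtain ⟨b', hb', hbb', hcb'⟩ := h2
  -- coordinate functionals are admissible
  have hadm : ∀ b ∈ B, sgAdm f S (φ b) := by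
    intro b hb
    refine sgAdm_of (A := B.erase b) (s := b) ((Finset.erase_subset _ _).trans hBS) ?_ ?_
      (hBS hb) ?_
    · intro i hi
      rw [hφ b i (Finset.mem_of_mem_erase hi), if_neg (Finset.ne_of_mem_erase hi)]
    · have := sgRk_insert_le (f := f) (A := B.erase b) (e := b)
      rw [Finset.insert_erase hb] at this
      omega
    · simp [hφ b b hb]
  set q : U →ₗ[ℝ] ℝ := φ b' (f e) • φ b - φ b (f e) • φ b' with hqdef
  have hqb : q (f b) = φ b' (f e) := by
    simp [hqdef, hφ b b hb, hφ b' b hb, hbb'.symm]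
  have hqb' : q (f b') = - φ b (f e) := by
    simp [hqdef, hφ b b' hb', hφ b' b' hb', hbb']
  have hqadm : sgAdm f S q := by
    refine sgAdm_of (A := insert e ((B.erase b).erase b')) (s := b) ?_ ?_ ?_ (hBS hb)
      (by rw [hqb]; exact hcb')
    · refine Finset.insert_subset he ?_
      exact ((Finset.erase_subset _ _).trans (Finset.erase_subset _ _)).trans hBS
    · intro i hi
      rcases Finset.mem_insert.1 hi with rfl | hi
      · simp [hqdef]; ring
      · simp only [Finset.mem_erase] at hi
        simp [hqdef, hφ b i hi.2.2, hφ b' i hi.2.2, hi.1, hi.2.1]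
    · have h3 : sgRk f S ≤ sgRk f (insert b (insert e ((B.erase b).erase b'))) := by
        rw [← hrkB]
        apply Submodule.finrank_mono
        refine sgSp_le fun i hi => ?_
        by_cases hib : i = b
        · subst hib; exact sgSp_mem (by simp)
        by_cases hib' : i = b'
        · subst hib'
          have hrest : ∑ x ∈ B.erase i, φ x (f e) • f x ∈
              sgSp f (insert b (insert e ((B.erase b).erase i))) := by
            refine Submodule.sum_mem _ fun x hx => Submodule.smul_mem _ _ (sgSp_mem ?_)
            simp only [Finset.mem_insert, Finset.mem_erase] at hx ⊢
            tauto
          have hee : f e ∈ sgSp f (insert b (insert e ((B.erase b).erase i))) :=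
            sgSp_mem (by simp)
          have hsum := Finset.add_sum_erase B (fun x => φ x (f e) • f x) hi
          have h4 : φ i (f e) • f i ∈ sgSp f (insert b (insert e ((B.erase b).erase i))) := by
            have h5 : φ i (f e) • f i = f e - ∑ x ∈ B.erase i, φ x (f e) • f x := by
              rw [eq_sub_iff_add_eq]
              exact hsum.trans hfe.symm
            rw [h5]
            exact Submodule.sub_mem _ hee hrest
          exact (Submodule.smul_mem_iff _ hcb').1 h4
        · exact sgSp_mem (by simp [hib, hib', hi])
      exact h3.trans sgRk_insert_le
  -- signs
  have hsgn : ∀ i ∈ S, ∃ ε : ℝ, ε * ε = 1 ∧ ε • f i ∈ sgCell f S l := by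
    intro i hi
    rcases hD i hi with h | h
    · exact ⟨1, by norm_num, by simpa using h⟩
    · exact ⟨-1, by norm_num, by simpa using h⟩
  obtain ⟨ε, hε, hεD⟩ := hsgn e he
  obtain ⟨ε1, hε1, hεD1⟩ := hsgn b (hBS hb)
  obtain ⟨ε2, hε2, hεD2⟩ := hsgn b' (hBS hb')
  have i1 := sgCell_sign hl (hadm b hb) hεD1 hεD
  have i2 := sgCell_sign hl (hadm b' hb') hεD2 hεD
  have i3 := sgCell_sign hl hqadm hεD1 hεD2
  simp only [map_smul, smul_eq_mul, hqb, hqb', hφ b b hb, hφ b' b' hb', if_true] at i1 i2 i3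
  have i4 := mul_nonneg i1 i2
  have e1 : ε1 * 1 * (ε * φ b (f e)) * (ε2 * 1 * (ε * φ b' (f e)))
      = (ε * ε) * (ε1 * ε2 * (φ b (f e) * φ b' (f e))) := by ring
  rw [e1, hε, one_mul] at i4
  have i5 : ε1 * ε2 * (φ b (f e) * φ b' (f e)) = 0 := by nlinarith
  have n1 : ε1 ≠ 0 := fun h => by simp [h] at hε1
  have n2 : ε2 ≠ 0 := fun h => by simp [h] at hε2
  exact (mul_ne_zero (mul_ne_zero n1 n2) (mul_ne_zero hcb hcb')) i5

theorem sg_key : ∀ (n : ℕ) (U : Type u) [AddCommGroup U] [Module ℝ U] [FiniteDimensional ℝ U]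
    (f : κ → U) (S : Finset κ) (l : U), S.card = n → 1 ≤ sgRk f S → sgGen f S l →
    (∀ q, sgAdm f S q → ∃ x ∈ sgCell f S l, x ≠ 0 ∧ q x = 0) → sgSep f S := by
  intro n
  induction n with
  | zero =>
    intro U _ _ _ f S l hS hr
    rw [Finset.card_eq_zero] at hS
    subst hS
    rw [sgRk_empty] at hr
    omega
  | succ n ih =>
    intro U _ _ _ f S l hS hr hl hall
    have hr2 : 2 ≤ sgRk f S := by
      by_contra hlt
      have h1 : sgRk f S = 1 := by omega
      obtain ⟨q, hq, -⟩ := sgAdm_of_rk (f := f) (S := S) (A := ∅) (by simp)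
        (by rw [sgRk_empty, h1])
      obtain ⟨x, hx, hx0, hqx⟩ := hall q hq
      have h2 := sgAdm_ker hq hx.1 hqx
      unfold sgAdm at hq
      have h3 : sgRk f (S.filter fun i => q (f i) = 0) = 0 := by omega
      unfold sgRk at h3
      rw [Submodule.finrank_eq_zero] at h3
      rw [h3] at h2
      exact hx0 (by simpa using h2)
    have hcard : 2 ≤ S.card := hr2.trans sgRk_le_card
    have single : ∀ e ∈ S, sgRk f {e} + sgRk f (S.erase e) ≤ sgRk f S → sgSep f S := by
      intro e he h
      refine ⟨{e}, S.erase e, by simp, ?_, by simp, ?_, h⟩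
      · rw [← Finset.card_pos, Finset.card_erase_of_mem he]; omega
      · rw [← Finset.insert_eq, Finset.insert_erase he]
    by_cases h0 : ∀ e ∈ S, f e ≠ 0
    swap
    · push Not at h0
      obtain ⟨e, he, hfe⟩ := h0
      refine single e he ?_
      have h1 : sgRk f {e} = 0 := by
        have h2 : f e ∈ sgSp f ∅ := by rw [hfe]; exact zero_mem _
        have h3 := sgRk_insert_eq h2
        rw [sgRk_empty] at h3
        simpa using h3
      have := sgRk_mono (f := f) (Finset.erase_subset e S)
      omega
    by_cases hcol : ∀ e ∈ S, sgRk f (S.erase e) = sgRk f S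
    swap
    · push Not at hcol
      obtain ⟨e, he, hfe⟩ := hcol
      refine single e he ?_
      have h1 : sgRk f {e} ≤ 1 := by simpa using sgRk_le_card (f := f) (A := {e})
      have := sgRk_mono (f := f) (Finset.erase_subset e S)
      omega
    have hsp : ∀ e ∈ S, sgSp f (S.erase e) = sgSp f S := fun e he =>
      Submodule.eq_of_le_of_finrank_eq (sgSp_mono (Finset.erase_subset _ _)) (hcol e he)
    have hdel : ∀ e ∈ S, sgSep f (S.erase e) := by
      intro e he
      refine ih U f (S.erase e) l (by rw [Finset.card_erase_of_mem he]; omega)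
        (by rw [hcol e he]; exact hr) ⟨by rw [hsp e he]; exact hl.1, fun q hq =>
          hl.2 q (sgAdm_erase (hcol e he) hq)⟩ ?_
      intro q hq
      obtain ⟨x, hx, hx0, hqx⟩ := hall q (sgAdm_erase (hcol e he) hq)
      exact ⟨x, ⟨by rw [hsp e he]; exact hx.1, fun q hq =>
        hx.2 q (sgAdm_erase (hcol e he) hq)⟩, hx0, hqx⟩
    by_cases hpar : ∀ e ∈ S, ∀ e' ∈ S, e ≠ e' → f e ∉ Submodule.span ℝ {f e'}
    swap
    · push Not at hpar
      obtain ⟨e, he, e', he', hne, hmem⟩ := hpar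
      obtain ⟨A, B, hA, hB, hAB, hABS, hrk⟩ := hdel e he
      have aux : ∀ A B : Finset κ, B.Nonempty → Disjoint A B → A ∪ B = S.erase e →
          sgRk f A + sgRk f B ≤ sgRk f (S.erase e) → e' ∈ A → sgSep f S := by
        intro A B hB hAB hABS hrk he'A
        refine ⟨insert e A, B, by simp, hB, ?_, ?_, ?_⟩
        · rw [Finset.disjoint_insert_left]
          refine ⟨fun h => ?_, hAB⟩
          have : e ∈ S.erase e := hABS ▸ Finset.mem_union_right _ h
          simp at this
        · rw [Finset.insert_union, hABS, Finset.insert_erase he]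
        · rw [sgRk_insert_eq, ← hcol e he]
          · exact hrk
          · exact (Submodule.span_singleton_le_iff_mem _ _).2 (sgSp_mem he'A) hmem
      have he'' : e' ∈ A ∪ B := by
        rw [hABS]; exact Finset.mem_erase.2 ⟨hne.symm, he'⟩
      rcases Finset.mem_union.1 he'' with h | h
      · exact aux A B hB hAB hABS hrk h
      · exact aux B A hA hAB.symm (by rw [Finset.union_comm]; exact hABS) (by omega) h
    by_cases hD : ∀ e ∈ S, f e ∈ sgCell f S l ∨ -f e ∈ sgCell f S l
    · have := sg_key_indep hl h0 hcol hpar hD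
      rw [this] at hcard
      simp at hcard
    push Not at hD
    obtain ⟨e, he, hD1, hD2⟩ := hD
    refine sgSep_tutte he (h0 e he) (hcol e he) (hdel e he) ?_
    have c := sgRk_contract (A := S.erase e) (h0 e he)
    rw [Finset.insert_erase he] at c
    refine ih (U ⧸ Submodule.span ℝ {f e}) _ (S.erase e) ((Submodule.span ℝ {f e}).mkQ l)
      (by rw [Finset.card_erase_of_mem he]; omega) (by omega)
      ⟨sgSp_contract hl.1, fun q hq => hl.2 _ (sgAdm_contract he (h0 e he) hq)⟩ ?_
    intro q hq
    obtain ⟨x, hx, hx0, hqx⟩ := hall _ (sgAdm_contract he (h0 e he) hq)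
    refine ⟨(Submodule.span ℝ {f e}).mkQ x, ⟨sgSp_contract hx.1, fun q' hq' hpos =>
      hx.2 _ (sgAdm_contract he (h0 e he) hq') hpos⟩, ?_, hqx⟩
    intro hz
    rw [← LinearMap.mem_ker, Submodule.ker_mkQ, Submodule.mem_span_singleton] at hz
    obtain ⟨a, rfl⟩ := hz
    have ha : a ≠ 0 := fun h => hx0 (by simp [h])
    rcases lt_or_gt_of_ne ha with h | h
    · refine hD2 ?_
      have := sgCell_smul hx (c := (-a)⁻¹) (by rw [inv_nonneg]; linarith)
      rw [smul_smul] at this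
      have e1 : (-a)⁻¹ * a = -1 := by field_simp
      rw [e1] at this
      simpa using this
    · refine hD1 ?_
      have := sgCell_smul hx (c := a⁻¹) (by rw [inv_nonneg]; linarith)
      rw [smul_smul] at this
      have e1 : a⁻¹ * a = 1 := by field_simp
      rw [e1] at this
      simpa using this



/-- Elementary independent subfamilies: their span contains no further directions of `S`. -/
def sgElem (f : κ → U) (S T : Finset κ) : Prop :=
  T ⊆ S ∧ LinearIndepOn ℝ f (T : Set κ) ∧
    ∀ i ∈ S, f i ∈ sgSp f T → ∃ t ∈ T, f i ∈ Submodule.span ℝ {f t}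

lemma sgElem_union {f : κ → U} {S A B T1 T2 : Finset κ} (h0 : ∀ i ∈ S, f i ≠ 0) (hA : A ⊆ S)
    (hB : B ⊆ S) (hdis : Disjoint (sgSp f A) (sgSp f B))
    (hfl : ∀ i ∈ S, f i ∈ sgSp f A ⊔ sgSp f B → i ∈ A ∨ i ∈ B)
    (h1 : sgElem f A T1) (h2 : sgElem f B T2) :
    sgElem f S (T1 ∪ T2) ∧ (T1 ∪ T2).card = T1.card + T2.card := by
  have e1 := sgSp_mono (f := f) h1.1
  have e2 := sgSp_mono (f := f) h2.1
  refine ⟨⟨Finset.union_subset (h1.1.trans hA) (h2.1.trans hB), ?_, ?_⟩, ?_⟩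
  · rw [Finset.coe_union]
    exact h1.2.1.union h2.2.1 (hdis.mono e1 e2)
  · intro i hi hmem
    rw [sgSp_union] at hmem
    obtain ⟨x, hx, y, hy, hxy⟩ := Submodule.mem_sup.1 hmem
    rcases hfl i hi (sup_le_sup e1 e2 hmem) with h | h
    · have hy0 : y = 0 := by
        refine Submodule.disjoint_def.1 hdis y ?_ (e2 hy)
        have : y = f i - x := by rw [← hxy]; abel
        rw [this]
        exact Submodule.sub_mem _ (sgSp_mem h) (e1 hx)
      rw [hy0, add_zero] at hxy
      obtain ⟨t, ht, ht2⟩ := h1.2.2 i h (hxy ▸ hx)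
      exact ⟨t, Finset.mem_union_left _ ht, ht2⟩
    · have hx0 : x = 0 := by
        refine Submodule.disjoint_def.1 hdis x (e1 hx) ?_
        have : x = f i - y := by rw [← hxy]; abel
        rw [this]
        exact Submodule.sub_mem _ (sgSp_mem h) (e2 hy)
      rw [hx0, zero_add] at hxy
      obtain ⟨t, ht, ht2⟩ := h2.2.2 i h (hxy ▸ hy)
      exact ⟨t, Finset.mem_union_right _ ht, ht2⟩
  · apply Finset.card_union_of_disjoint
    rw [Finset.disjoint_left]
    intro i hi hi2
    exact h0 i (hA (h1.1 hi)) (Submodule.disjoint_def.1 hdis _ (e1 (sgSp_mem hi)) (e2 (sgSp_mem hi2)))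

lemma sgElem_flat {f : κ → U} {S T : Finset κ} {q : U →ₗ[ℝ] ℝ}
    (h : sgElem f (S.filter fun i => q (f i) = 0) T) : sgElem f S T := by
  refine ⟨h.1.trans (Finset.filter_subset _ _), h.2.1, fun i hi hmem => h.2.2 i ?_ hmem⟩
  refine Finset.mem_filter.2 ⟨hi, ?_⟩
  have : sgSp f T ≤ LinearMap.ker q := sgSp_le_ker fun j hj => (Finset.mem_filter.1 (h.1 hj)).2
  exact this hmem

lemma sgGen_exists (f : κ → U) (S : Finset κ) : ∃ l, sgGen f S l := by
  by_contra! hno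
  have hcov : (⋃ T : {T : Finset κ // T ∈ S.powerset ∧ sgRk f T + 1 = sgRk f S},
      (((sgSp f T.1).comap (sgSp f S).subtype : Submodule ℝ (sgSp f S)) : Set (sgSp f S)))
      = Set.univ := by
    ext x
    simp only [Set.mem_iUnion, Set.mem_univ, iff_true]
    have h := hno x.1
    unfold sgGen at h
    push Not at h
    obtain ⟨q, hq, hx⟩ := h x.2
    exact ⟨⟨S.filter fun i => q (f i) = 0, by simp, hq⟩, sgAdm_ker hq x.2 hx⟩
  have : Finite {T : Finset κ // T ∈ S.powerset ∧ sgRk f T + 1 = sgRk f S} :=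
    Finite.of_injective (fun T => (⟨T.1, T.2.1⟩ : {T // T ∈ S.powerset})) (by
      intro a b hab
      simpa [Subtype.ext_iff] using hab)
  obtain ⟨⟨T, hT, hrk⟩, htop⟩ := Subspace.exists_eq_top_of_iUnion_eq_univ hcov
  have hle : sgSp f S ≤ sgSp f T := by
    intro x hx
    have : (⟨x, hx⟩ : sgSp f S) ∈ (sgSp f T).comap (sgSp f S).subtype := by
      rw [htop]; trivial
    exact this
  have := Submodule.finrank_mono hle
  unfold sgRk at hrk
  omega

lemma sgAdm_exists_ne {f : κ → U} {S : Finset κ} {e : κ} (he : e ∈ S) (hf : f e ≠ 0) :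
    ∃ q, sgAdm f S q ∧ q (f e) ≠ 0 := by
  obtain ⟨b, hb, heb, hsp, hli⟩ := exists_linearIndepOn_extension (K := ℝ) (v := f) (s := {e})
    (t := (S : Set κ)) (LinearIndepOn.singleton hf) (by simpa using he)
  have hfin : b.Finite := S.finite_toSet.subset hb
  lift b to Finset κ using hfin
  have hb' : b ⊆ S := by simpa using hb
  have heb' : e ∈ b := by simpa using heb
  obtain ⟨φ, hφ⟩ := sg_dual hli (fun i => if i = e then 1 else 0)
  have hφe : φ (f e) ≠ 0 := by simp [hφ e heb']
  refine ⟨φ, sgAdm_of (A := b.erase e) ((Finset.erase_subset _ _).trans hb') ?_ ?_ he hφe, hφe⟩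
  · intro i hi
    rw [hφ i (Finset.mem_of_mem_erase hi), if_neg (Finset.ne_of_mem_erase hi)]
  · have h1 : sgRk f S ≤ sgRk f b := Submodule.finrank_mono (Submodule.span_le.2 hsp)
    have := sgRk_insert_le (f := f) (A := b.erase e) (e := e)
    rw [Finset.insert_erase heb'] at this
    omega

lemma sg_min {f : κ → U} {S : Finset κ} {e : κ} (he : e ∈ S) (hf : f e ≠ 0) {l : U}
    (hl : sgGen f S l) : ∃ v, sgAdm f S v ∧ v l = 1 ∧ v (f e) ≠ 0 ∧
      ∀ ψ, sgAdm f S ψ → ψ l = 1 → ψ (f e) ≠ 0 → |v (f e)| ≤ |ψ (f e)| := by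
  let P : Finset κ → (U →ₗ[ℝ] ℝ) → Prop := fun T q =>
    sgAdm f S q ∧ q l = 1 ∧ q (f e) ≠ 0 ∧ (S.filter fun i => q (f i) = 0) = T
  let g : Finset κ → ℝ := fun T => if h : ∃ q, P T q then |h.choose (f e)| else 0
  have hg : ∀ q T, P T q → g T = |q (f e)| := by
    intro q T hq
    have hex : ∃ q, P T q := ⟨q, hq⟩
    have h1 : g T = |hex.choose (f e)| := dif_pos hex
    have h2 := hex.choose_spec
    have h3 : f e - q (f e) • l ∈ sgSp f (S.filter fun i => q (f i) = 0) :=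
      sgAdm_ker hq.1 (Submodule.sub_mem _ (sgSp_mem he) (Submodule.smul_mem _ _ hl.1))
        (by simp [hq.2.1])
    rw [hq.2.2.2, ← h2.2.2.2] at h3
    have h4 : hex.choose (f e - q (f e) • l) = 0 := sgSp_le_ker (by simp) h3
    rw [map_sub, map_smul, h2.2.1, smul_eq_mul, mul_one, sub_eq_zero] at h4
    rw [h1, h4]
  obtain ⟨q0, hq0, hq0e⟩ := sgAdm_exists_ne he hf
  have hn := hl.2 q0 hq0
  have hP0 : P (S.filter fun i => ((q0 l)⁻¹ • q0) (f i) = 0) ((q0 l)⁻¹ • q0) :=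
    ⟨sgAdm_smul hq0 (inv_ne_zero hn), by simp [hn], by simp [hn, hq0e], rfl⟩
  obtain ⟨T, hT, hmin⟩ := Finset.exists_min_image
    (S.powerset.filter fun T => ∃ q, P T q) g
    ⟨_, Finset.mem_filter.2 ⟨by simp, _, hP0⟩⟩
  obtain ⟨-, v, hv⟩ := Finset.mem_filter.1 hT
  refine ⟨v, hv.1, hv.2.1, hv.2.2.1, fun ψ h1 h2 h3 => ?_⟩
  have hP : P (S.filter fun i => ψ (f i) = 0) ψ := ⟨h1, h2, h3, rfl⟩
  have := hmin _ (Finset.mem_filter.2 ⟨by simp, ψ, hP⟩)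
  rwa [hg _ _ hv, hg _ _ hP] at this

lemma sgRk_union_disj {f : κ → U} {A B : Finset κ} (h : Disjoint (sgSp f A) (sgSp f B)) :
    sgRk f (A ∪ B) = sgRk f A + sgRk f B := by
  have h1 := Submodule.finrank_sup_add_finrank_inf_eq (sgSp f A) (sgSp f B)
  rw [h.eq_bot, finrank_bot] at h1
  unfold sgRk
  rw [sgSp_union]
  omega

/-- A minimal separator. -/
lemma sg_component {f : κ → U} {W : Finset κ} (hW : W.Nonempty) :
    ∃ A B : Finset κ, A.Nonempty ∧ Disjoint A B ∧ A ∪ B = W ∧ Disjoint (sgSp f A) (sgSp f B) ∧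
      ¬ sgSep f A := by
  obtain ⟨A, hA, hmin⟩ := Finset.exists_min_image (W.powerset.filter fun A =>
    A.Nonempty ∧ sgRk f A + sgRk f (W \ A) ≤ sgRk f W) Finset.card
    ⟨W, by simp [hW, sgRk_empty]⟩
  simp only [Finset.mem_filter, Finset.mem_powerset] at hA hmin
  obtain ⟨hAW, hAne, hrk⟩ := hA
  refine ⟨A, W \ A, hAne, Finset.disjoint_sdiff, Finset.union_sdiff_of_subset hAW, ?_, ?_⟩
  · have h1 := Submodule.finrank_sup_add_finrank_inf_eq (sgSp f A) (sgSp f (W \ A))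
    rw [← sgSp_union, Finset.union_sdiff_of_subset hAW] at h1
    rw [disjoint_iff, ← Submodule.finrank_eq_zero (R := ℝ)]
    unfold sgRk at hrk
    omega
  · rintro ⟨C, D, hC, hD, hCD, hCDA, hr⟩
    have hCA : C ⊆ A := hCDA ▸ Finset.subset_union_left
    have hlt : C.card < A.card := by
      have := Finset.card_union_of_disjoint hCD
      rw [hCDA] at this
      have := Finset.card_pos.2 hD
      omega
    have hsub : W \ C ⊆ D ∪ (W \ A) := by
      intro x hx
      simp only [Finset.mem_sdiff, Finset.mem_union] at hx ⊢
      by_cases hxA : x ∈ A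
      · rw [← hCDA, Finset.mem_union] at hxA
        tauto
      · tauto
    have h1 := (sgRk_mono (f := f) hsub).trans sgRk_union_le
    have := hmin C ⟨hCA.trans hAW, hC, by omega⟩
    omega

lemma sg_step {f : κ → U} {S : Finset κ} (h0 : ∀ i ∈ S, f i ≠ 0) (hr3 : 2 ≤ sgRk f S)
    (hodd : sgRk f S % 2 = 1)
    (ih : ∀ S' : Finset κ, S' ⊆ S → sgRk f S' < sgRk f S →
      ∃ T, sgElem f S' T ∧ sgRk f S' ≤ 2 * T.card) :
    ∃ T, sgElem f S T ∧ sgRk f S ≤ 2 * T.card := by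
  have hne : S.Nonempty := by
    rw [Finset.nonempty_iff_ne_empty]
    rintro rfl
    rw [sgRk_empty] at hr3
    omega
  obtain ⟨v0, hv0⟩ := hne
  obtain ⟨l, hl⟩ := sgGen_exists f S
  obtain ⟨v, hv, hvl, ht, hmin⟩ := sg_min hv0 (h0 v0 hv0) hl
  set W := S.filter fun i => v (f i) = 0 with hWdef
  have hWS : W ⊆ S := Finset.filter_subset _ _
  have hrW : sgRk f W + 1 = sgRk f S := hv
  have hWker : sgSp f W ≤ LinearMap.ker v := sgSp_le_ker (by simp [hWdef])
  set t := v (f v0) with htdef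
  let π : U →ₗ[ℝ] U := LinearMap.id - t⁻¹ • v.smulRight (f v0)
  have hπ : ∀ x, π x = x - (t⁻¹ * v x) • f v0 := by
    intro x; simp [π, smul_smul]
  have hvπ : ∀ x, v (π x) = 0 := by
    intro x
    rw [hπ, map_sub, map_smul, ← htdef, smul_eq_mul]
    field_simp
    ring
  have hπid : ∀ x, v x = 0 → π x = x := by
    intro x hx; rw [hπ, hx]; simp
  have hπv0 : π (f v0) = 0 := by
    rw [hπ, ← htdef, inv_mul_cancel₀ ht]; simp
  have hπW : ∀ x ∈ sgSp f S, π x ∈ sgSp f W := by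
    intro x hx
    refine sgAdm_ker hv ?_ (hvπ x)
    rw [hπ]
    exact Submodule.sub_mem _ hx (Submodule.smul_mem _ _ (sgSp_mem hv0))
  have hfilt : ∀ q : U →ₗ[ℝ] ℝ, ∀ g, v (f g) ≠ 0 →
      sgRk f (insert g (W.filter fun i => q (f i) = 0)) =
      sgRk f (W.filter fun i => q (f i) = 0) + 1 := by
    intro q g hg
    refine sgRk_insert_lt fun h => hg ?_
    exact hWker (sgSp_mono (Finset.filter_subset _ _) h)
  have hadm : ∀ q, sgAdm f W q → sgAdm f S (q.comp π) := by
    intro q hq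
    obtain ⟨s, hs, hsq⟩ := sgAdm_exists hq
    have hr := hfilt q v0 ht
    unfold sgAdm at hq
    refine sgAdm_of (A := insert v0 (W.filter fun i => q (f i) = 0)) (s := s) ?_ ?_ ?_ (hWS hs) ?_
    · exact Finset.insert_subset hv0 ((Finset.filter_subset _ _).trans hWS)
    · intro i hi
      rcases Finset.mem_insert.1 hi with rfl | hi
      · simp [hπv0]
      · have h1 := Finset.mem_filter.1 hi
        have h2 := Finset.mem_filter.1 h1.1
        simp [hπid _ h2.2, h1.2]
    · omega
    · have h2 := Finset.mem_filter.1 hs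
      simpa [hπid _ h2.2] using hsq
  have hgenW : sgGen f W (π l) := ⟨hπW l hl.1, fun q hq => hl.2 _ (hadm q hq)⟩
  have hcell : ∀ g ∈ S, v (f g) ≠ 0 → v (f g) • π (f g) ∈ sgCell f W (π l) := by
    intro g hg hvg
    refine ⟨Submodule.smul_mem _ _ (hπW _ (sgSp_mem hg)), fun q hq hpos => ?_⟩
    by_contra! hneg
    rw [map_smul, smul_eq_mul] at hneg
    set q1 : U →ₗ[ℝ] ℝ := (q (π l))⁻¹ • q.comp π with hq1
    have hq1l : q1 l = 1 := by simp [hq1, hpos.ne']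
    have hq1v0 : q1 (f v0) = 0 := by simp [hq1, hπv0]
    have hac : v (f g) * q1 (f g) < 0 := by
      have : v (f g) * q1 (f g) = (q (π l))⁻¹ * (v (f g) * q (π (f g))) := by
        simp [hq1]; ring
      rw [this]
      exact mul_neg_of_pos_of_neg (inv_pos.2 hpos) hneg
    set a := q1 (f g) with ha
    set c := v (f g) with hc
    have hane : a ≠ 0 := by rintro h; rw [h] at hac; simp at hac
    have hac' : a - c ≠ 0 := by
      intro h
      have : a = c := by linarith
      rw [this] at hac
      nlinarith [mul_self_nonneg c]
    set ψ : U →ₗ[ℝ] ℝ := (a - c)⁻¹ • (a • v - c • q1) with hψ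
    have hψl : ψ l = 1 := by simp [hψ, hvl, hq1l, hac']
    have hψv0 : ψ (f v0) = (a - c)⁻¹ * (a * t) := by simp [hψ, hq1v0, htdef]
    have hψne : ψ (f v0) ≠ 0 := by
      rw [hψv0]; exact mul_ne_zero (inv_ne_zero hac') (mul_ne_zero hane ht)
    have hψadm : sgAdm f S ψ := by
      have hr := hfilt q g hvg
      unfold sgAdm at hq
      refine sgAdm_of (A := insert g (W.filter fun i => q (f i) = 0)) (s := v0) ?_ ?_ ?_ hv0 hψne
      · exact Finset.insert_subset hg ((Finset.filter_subset _ _).trans hWS)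
      · intro i hi
        rcases Finset.mem_insert.1 hi with rfl | hi
        · have : ψ (f i) = (a - c)⁻¹ * (a * c - c * a) := by simp [hψ, ← ha, ← hc]
          rw [this]; ring
        · have h1 := Finset.mem_filter.1 hi
          have h2 := Finset.mem_filter.1 h1.1
          have h3 : q1 (f i) = 0 := by simp [hq1, hπid _ h2.2, h1.2]
          simp [hψ, h2.2, h3]
      · omega
    have hle := hmin ψ hψadm hψl hψne
    rw [hψv0, abs_mul, abs_mul, abs_inv] at hle
    have hlt : |a| < |a - c| := by
      rw [← sq_lt_sq]
      nlinarith [mul_self_nonneg c]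
    have htpos : 0 < |t| := abs_pos.2 ht
    have hpos2 : 0 < |a - c| := abs_pos.2 hac'
    rw [inv_mul_eq_div, le_div_iff₀ hpos2] at hle
    nlinarith
  -- component
  have hWne : W.Nonempty := by
    rw [Finset.nonempty_iff_ne_empty]
    intro h
    rw [h, sgRk_empty] at hrW
    omega
  obtain ⟨A, B, hAne, hAB, hABW, hdis, hsep⟩ := sg_component (f := f) hWne
  have hAW : A ⊆ W := hABW ▸ Finset.subset_union_left
  have hBW : B ⊆ W := hABW ▸ Finset.subset_union_right
  have hrAB : sgRk f W = sgRk f A + sgRk f B := by rw [← hABW]; exact sgRk_union_disj hdis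
  have hrA : 1 ≤ sgRk f A := by
    obtain ⟨i, hi⟩ := hAne
    by_contra h
    have h1 : sgRk f A = 0 := by omega
    unfold sgRk at h1
    rw [Submodule.finrank_eq_zero] at h1
    have h2 := sgSp_mem (f := f) hi
    rw [h1] at h2
    exact h0 i (hWS (hAW hi)) (by simpa using h2)
  rcases Nat.mod_two_eq_zero_or_one (sgRk f A) with hpar | hpar
  swap
  · obtain ⟨T1, hT1, hc1⟩ := ih A (hAW.trans hWS) (by omega)
    obtain ⟨T2, hT2, hc2⟩ := ih B (hBW.trans hWS) (by omega)
    obtain ⟨hT, hcard⟩ := sgElem_union (S := W) (fun i hi => h0 i (hWS hi)) hAW hBW hdis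
      (fun i hi _ => by rw [← hABW] at hi; exact Finset.mem_union.1 hi) hT1 hT2
    exact ⟨T1 ∪ T2, sgElem_flat hT, by omega⟩
  obtain ⟨A', hBA', hcompl⟩ : ∃ A', sgSp f B ≤ A' ∧ IsCompl (sgSp f A) A' := by
    obtain ⟨C, hC1, hC2⟩ := hdis.symm.exists_isCompl
    exact ⟨_, hC1, hC2.symm⟩
  let p : U →ₗ[ℝ] U := (sgSp f A).projection A' hcompl
  have hpA : ∀ x ∈ sgSp f A, p x = x := fun x hx =>
    Submodule.projection_apply_of_mem_left hcompl hx
  have hpB : ∀ x ∈ sgSp f B, p x = 0 := fun x hx =>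
    (Submodule.projection_apply_eq_zero_iff hcompl).2 (hBA' hx)
  have hpmem : ∀ x, p x ∈ sgSp f A := fun x => Submodule.projection_apply_mem hcompl x
  have hadmA : ∀ q, sgAdm f A q → sgAdm f W (q.comp p) := by
    intro q hq
    obtain ⟨s, hs, hsq⟩ := sgAdm_exists hq
    have hr := sgRk_union_disj (f := f) (A := A.filter fun i => q (f i) = 0) (B := B)
      (hdis.mono_left (sgSp_mono (Finset.filter_subset _ _)))
    unfold sgAdm at hq
    refine sgAdm_of (A := (A.filter fun i => q (f i) = 0) ∪ B) (s := s) ?_ ?_ ?_ (hAW hs) ?_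
    · exact Finset.union_subset ((Finset.filter_subset _ _).trans hAW) hBW
    · intro i hi
      rcases Finset.mem_union.1 hi with hi | hi
      · have h1 := Finset.mem_filter.1 hi
        simp [hpA _ (sgSp_mem h1.1), h1.2]
      · simp [hpB _ (sgSp_mem hi)]
    · omega
    · simpa [hpA _ (sgSp_mem hs)] using hsq
  have hgenA : sgGen f A (p (π l)) := ⟨hpmem _, fun q hq => hgenW.2 _ (hadmA q hq)⟩
  have hex : ∃ q, sgAdm f A q ∧ ∀ x ∈ sgCell f A (p (π l)), q x = 0 → x = 0 := by
    by_contra! h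
    refine hsep (sg_key _ U f A _ rfl hrA hgenA fun q hq => ?_)
    obtain ⟨x, hx, hqx, hx0⟩ := h q hq
    exact ⟨x, hx, hx0, hqx⟩
  obtain ⟨q, hq, hqtriv⟩ := hex
  set A1 := A.filter fun i => q (f i) = 0 with hA1
  set B2 := S.filter fun i => f i ∈ sgSp f (insert v0 B) with hB2
  have hA1A : A1 ⊆ A := Finset.filter_subset _ _
  have hspB2 : sgSp f B2 = sgSp f (insert v0 B) := by
    apply le_antisymm
    · exact sgSp_le fun i hi => (Finset.mem_filter.1 hi).2
    · refine sgSp_mono fun i hi => Finset.mem_filter.2 ⟨?_, sgSp_mem hi⟩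
      rcases Finset.mem_insert.1 hi with rfl | hi
      · exact hv0
      · exact hWS (hBW hi)
  have hrB2 : sgRk f B2 = sgRk f B + 1 := by
    have : sgRk f B2 = sgRk f (insert v0 B) := by unfold sgRk; rw [hspB2]
    rw [this]
    exact sgRk_insert_lt fun h => ht (hWker (sgSp_mono hBW h))
  have hrA1 : sgRk f A1 + 1 = sgRk f A := hq
  have hB2mem : ∀ x ∈ sgSp f (insert v0 B), π x ∈ sgSp f B := by
    intro x hx
    have : sgSp f (insert v0 B) ≤ (sgSp f B).comap π := by
      refine sgSp_le fun i hi => ?_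
      rw [Submodule.mem_comap]
      rcases Finset.mem_insert.1 hi with rfl | hi
      · rw [hπv0]; exact zero_mem _
      · rw [hπid _ (hWker (sgSp_mono hBW (sgSp_mem hi)))]
        exact sgSp_mem hi
    exact this hx
  have hdis2 : Disjoint (sgSp f A1) (sgSp f B2) := by
    rw [Submodule.disjoint_def]
    intro x hx hx2
    rw [hspB2] at hx2
    have h1 := hB2mem x hx2
    rw [hπid x (hWker (sgSp_mono (hA1A.trans hAW) hx))] at h1
    exact Submodule.disjoint_def.1 hdis x (sgSp_mono hA1A hx) h1
  obtain ⟨T1, hT1, hc1⟩ := ih A1 ((hA1A.trans hAW).trans hWS) (by omega)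
  obtain ⟨T2, hT2, hc2⟩ := ih B2 (Finset.filter_subset _ _) (by omega)
  obtain ⟨hT, hcard⟩ := sgElem_union h0 ((hA1A.trans hAW).trans hWS)
    (Finset.filter_subset _ _) hdis2 (fun i hi hmem => by
      have hq0 : q (p (π (f i))) = 0 := by
        have hle : sgSp f A1 ⊔ sgSp f B2 ≤ LinearMap.ker ((q.comp p).comp π) := by
          refine sup_le ?_ ?_
          · refine sgSp_le fun j hj => ?_
            have h1 := Finset.mem_filter.1 hj
            have h2 := Finset.mem_filter.1 (hAW h1.1)
            simp [hπid _ h2.2, hpA _ (sgSp_mem h1.1), h1.2]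
          · intro x hx
            rw [hspB2] at hx
            simp [hpB _ (hB2mem x hx)]
        exact hle hmem
      by_cases hvi : v (f i) = 0
      · have hiW : i ∈ W := Finset.mem_filter.2 ⟨hi, hvi⟩
        rw [← hABW, Finset.mem_union] at hiW
        rcases hiW with h | h
        · left
          rw [hπid _ hvi, hpA _ (sgSp_mem h)] at hq0
          exact Finset.mem_filter.2 ⟨h, hq0⟩
        · right
          exact Finset.mem_filter.2 ⟨hi, sgSp_mem (Finset.mem_insert_of_mem h)⟩
      · right
        have hc := hcell i hi hvi
        have hc' : p (v (f i) • π (f i)) ∈ sgCell f A (p (π l)) :=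
          ⟨hpmem _, fun q' hq' hpos => hc.2 _ (hadmA q' hq') hpos⟩
        have hz := hqtriv _ hc' (by rw [map_smul, map_smul, hq0, smul_zero])
        rw [map_smul, smul_eq_zero] at hz
        have hz2 : p (π (f i)) = 0 := hz.resolve_left hvi
        have hπi : π (f i) ∈ sgSp f A ⊔ sgSp f B := by
          rw [← sgSp_union, hABW]; exact hπW _ (sgSp_mem hi)
        obtain ⟨x, hx, y, hy, hxy⟩ := Submodule.mem_sup.1 hπi
        rw [← hxy, map_add, hpA x hx, hpB y hy, add_zero] at hz2
        rw [hz2, zero_add] at hxy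
        refine Finset.mem_filter.2 ⟨hi, ?_⟩
        have h5 : f i = π (f i) + (t⁻¹ * v (f i)) • f v0 := by rw [hπ]; abel
        rw [h5]
        refine Submodule.add_mem _ ?_ (Submodule.smul_mem _ _ (sgSp_mem (by simp)))
        rw [← hxy]
        exact sgSp_mono (Finset.subset_insert _ _) hy) hT1 hT2
  exact ⟨T1 ∪ T2, hT, by omega⟩

/-- Bonnice–Edelstein / Hansen: a configuration of rank `r` has an elementary subfamily with at
least `r / 2` members. -/
theorem sg_elementary (f : κ → U) : ∀ (r : ℕ) (S : Finset κ), (∀ i ∈ S, f i ≠ 0) →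
    sgRk f S = r → ∃ T, sgElem f S T ∧ sgRk f S ≤ 2 * T.card := by
  intro r
  induction r using Nat.strong_induction_on with
  | _ r ih =>
    intro S h0 hr
    have ih' : ∀ S' : Finset κ, S' ⊆ S → sgRk f S' < sgRk f S →
      ∃ T, sgElem f S' T ∧ sgRk f S' ≤ 2 * T.card := fun S' hS' hlt =>
        ih _ (by omega) S' (fun i hi => h0 i (hS' hi)) rfl
    rcases S.eq_empty_or_nonempty with rfl | ⟨v0, hv0⟩
    · refine ⟨∅, ⟨by simp, by simp, by simp⟩, by rw [sgRk_empty]; omega⟩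
    obtain ⟨q, hq, hqv⟩ := sgAdm_exists_ne hv0 (h0 v0 hv0)
    have hq' : sgRk f (S.filter fun i => q (f i) = 0) + 1 = sgRk f S := hq
    by_cases hodd : sgRk f S % 2 = 1
    · by_cases h1 : 2 ≤ sgRk f S
      · exact sg_step h0 h1 hodd ih'
      · refine ⟨{v0}, ⟨by simpa using hv0, ?_, ?_⟩, by simp; omega⟩
        · simpa using LinearIndepOn.singleton (R := ℝ) (h0 v0 hv0)
        · intro i hi hmem
          exact ⟨v0, by simp, by simpa [sgSp] using hmem⟩
    · obtain ⟨T, hT, hc⟩ := ih' (S.filter fun i => q (f i) = 0) (Finset.filter_subset _ _)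
        (by omega)
      exact ⟨T, sgElem_flat hT, by omega⟩




section Final

variable [Fintype κ]

lemma fin_perturb (V : κ → U) (φ ψ : U →ₗ[ℝ] ℝ) :
    ∃ χ : U →ₗ[ℝ] ℝ, ∀ i, (0 < φ (V i) → 0 < χ (V i)) ∧ (φ (V i) < 0 → χ (V i) < 0) ∧
      (φ (V i) = 0 → 0 < ψ (V i) → 0 < χ (V i)) ∧
      (φ (V i) = 0 → ψ (V i) < 0 → χ (V i) < 0) := by
  have key : ∀ i, ∀ᶠ e in nhdsWithin (0 : ℝ) (Set.Ioi 0),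
      (0 < φ (V i) → 0 < φ (V i) + e * ψ (V i)) ∧ (φ (V i) < 0 → φ (V i) + e * ψ (V i) < 0) := by
    intro i
    have hc : Filter.Tendsto (fun e : ℝ => φ (V i) + e * ψ (V i))
        (nhdsWithin (0 : ℝ) (Set.Ioi 0)) (nhds (φ (V i))) := by
      have : Continuous (fun e : ℝ => φ (V i) + e * ψ (V i)) := by fun_prop
      have h := this.tendsto 0
      simp only [zero_mul, add_zero] at h
      exact h.mono_left nhdsWithin_le_nhds
    refine Filter.Eventually.and ?_ ?_
    · by_cases h : 0 < φ (V i)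
      · filter_upwards [hc.eventually (lt_mem_nhds h)] with e he _ using he
      · exact Filter.Eventually.of_forall fun e h' => absurd h' h
    · by_cases h : φ (V i) < 0
      · filter_upwards [hc.eventually (gt_mem_nhds h)] with e he _ using he
      · exact Filter.Eventually.of_forall fun e h' => absurd h' h
  have hall := Filter.eventually_all.2 key
  obtain ⟨e, he, hpos⟩ := (hall.and self_mem_nhdsWithin).exists
  have hpos : 0 < e := hpos
  refine ⟨φ + e • ψ, fun i => ?_⟩
  have hv : (φ + e • ψ) (V i) = φ (V i) + e * ψ (V i) := by simp
  rw [hv]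
  refine ⟨(he i).1, (he i).2, fun h hs => ?_, fun h hs => ?_⟩
  · rw [h, zero_add]; exact mul_pos hpos hs
  · rw [h, zero_add]; exact mul_neg_of_pos_of_neg hpos hs

/-- Every functional can be made nonvanishing. -/
lemma fin_generic (V : κ → U) (h0 : ∀ i, V i ≠ 0) (φ : U →ₗ[ℝ] ℝ) :
    ∃ χ : U →ₗ[ℝ] ℝ, ∀ i, χ (V i) ≠ 0 ∧ (0 < φ (V i) → 0 < χ (V i)) := by
  obtain ⟨ψ, hψ⟩ := Module.exists_dual_forall_apply_ne_zero (K := ℝ) V h0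
  obtain ⟨χ, hχ⟩ := fin_perturb V φ ψ
  refine ⟨χ, fun i => ⟨?_, (hχ i).1⟩⟩
  obtain ⟨h1, h2, h3, h4⟩ := hχ i
  rcases lt_trichotomy (φ (V i)) 0 with h | h | h
  · exact (h2 h).ne
  · rcases lt_or_gt_of_ne (hψ i) with h' | h'
    · exact (h4 h h').ne
    · exact (h3 h h').ne'
  · exact (h1 h).ne'

lemma fin_np_sub (V : κ → U) (S : Finset κ) (φ : U →ₗ[ℝ] ℝ) :
    nonposCount φ (subfam V S) = (S.filter fun i => φ (V i) ≤ 0).card := by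
  unfold nonposCount subfam
  refine Finset.card_bij (fun a _ => a.1) ?_ ?_ ?_
  · intro a ha
    simp only [Finset.mem_filter, Finset.mem_univ, true_and] at ha
    simp [ha]
  · intro a _ b _ h
    exact Subtype.ext h
  · intro b hb
    simp only [Finset.mem_filter] at hb
    exact ⟨⟨b, hb.1⟩, by simp [hb.2], rfl⟩

lemma fin_cg_le {κ' : Type*} [Fintype κ'] [hn : Nontrivial U] (V : κ' → U) {φ : U →ₗ[ℝ] ℝ}
    (h : φ ≠ 0) : codegStar V ≤ nonposCount φ V := by
  unfold codegStar
  rw [if_pos hn]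
  exact Nat.sInf_le ⟨φ, h, rfl⟩

lemma fin_cg_ex {κ' : Type*} [Fintype κ'] [hn : Nontrivial U] (V : κ' → U) :
    ∃ φ : U →ₗ[ℝ] ℝ, φ ≠ 0 ∧ nonposCount φ V = codegStar V := by
  obtain ⟨φ0, h0⟩ := exists_ne (0 : U →ₗ[ℝ] ℝ)
  have h := Nat.sInf_mem (s := {k | ∃ φ : U →ₗ[ℝ] ℝ, φ ≠ 0 ∧ nonposCount φ V = k})
    ⟨_, φ0, h0, rfl⟩
  unfold codegStar
  rw [if_pos hn]
  exact h

/-- Sum of signs. -/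
def fin_sgn (V : κ → U) (φ : U →ₗ[ℝ] ℝ) (S : Finset κ) : ℤ :=
  ∑ i ∈ S, (SignType.sign (φ (V i)) : ℤ)

lemma fin_sgn_univ (V : κ → U) (φ : U →ₗ[ℝ] ℝ) :
    fin_sgn V φ Finset.univ = (posCount φ V : ℤ) - (negCount φ V : ℤ) := by
  unfold fin_sgn posCount negCount
  rw [Finset.card_filter, Finset.card_filter]
  push_cast
  rw [← Finset.sum_sub_distrib]
  refine Finset.sum_congr rfl fun i _ => ?_
  rcases lt_trichotomy (φ (V i)) 0 with h | h | h
  · simp [h, h.not_gt]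
  · simp [h]
  · simp [h, h.not_gt]

lemma fin_sgn_le_disc (V : κ → U) (φ : U →ₗ[ℝ] ℝ) :
    fin_sgn V φ Finset.univ ≤ disc V := by
  have hb : BddAbove {k | ∃ φ : U →ₗ[ℝ] ℝ,
      k = ((posCount φ V : ℤ) - (negCount φ V : ℤ)).natAbs} := by
    refine ⟨Fintype.card κ, ?_⟩
    rintro k ⟨φ, rfl⟩
    have h1 : posCount φ V ≤ Fintype.card κ := Finset.card_le_univ _
    have h2 : negCount φ V ≤ Fintype.card κ := Finset.card_le_univ _
    omega
  have h := le_csSup hb ⟨φ, rfl⟩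
  rw [fin_sgn_univ]
  unfold disc
  omega

/-- Antiparallel pairs. -/
def finAP (V : κ → U) (P : Finset κ) : Prop :=
  ∃ i j : κ, ∃ c : ℝ, i ≠ j ∧ c < 0 ∧ V j = c • V i ∧ P = {i, j}

lemma finAP_sgn {V : κ → U} {P : Finset κ} (h : finAP V P) (φ : U →ₗ[ℝ] ℝ) :
    fin_sgn V φ P = 0 := by
  obtain ⟨i, j, c, hij, hc, hV, rfl⟩ := h
  unfold fin_sgn
  rw [Finset.sum_pair hij, hV, map_smul, smul_eq_mul, sign_mul, sign_neg hc]
  simp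

lemma finAP_one {V : κ → U} {P : Finset κ} (h : finAP V P) (φ : U →ₗ[ℝ] ℝ)
    (hφ : ∀ i, φ (V i) ≠ 0) : (P.filter fun i => φ (V i) ≤ 0).card = 1 := by
  obtain ⟨i, j, c, hij, hc, hV, rfl⟩ := h
  have hj : φ (V j) = c * φ (V i) := by rw [hV, map_smul, smul_eq_mul]
  rw [Finset.card_eq_one]
  rcases lt_or_gt_of_ne (hφ i) with h | h
  · have : 0 < φ (V j) := by rw [hj]; exact mul_pos_of_neg_of_neg hc h
    refine ⟨i, ?_⟩
    ext x
    simp only [Finset.mem_filter, Finset.mem_insert, Finset.mem_singleton]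
    constructor
    · rintro ⟨rfl | rfl, hx⟩
      · rfl
      · linarith
    · rintro rfl
      exact ⟨Or.inl rfl, h.le⟩
  · have : φ (V j) < 0 := by rw [hj]; exact mul_neg_of_neg_of_pos hc h
    refine ⟨j, ?_⟩
    ext x
    simp only [Finset.mem_filter, Finset.mem_insert, Finset.mem_singleton]
    constructor
    · rintro ⟨rfl | rfl, hx⟩
      · linarith
      · rfl
    · rintro rfl
      exact ⟨Or.inr rfl, this.le⟩

lemma finAP_ge {V : κ → U} {P : Finset κ} (h : finAP V P) (φ : U →ₗ[ℝ] ℝ) :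
    1 ≤ (P.filter fun i => φ (V i) ≤ 0).card := by
  obtain ⟨i, j, c, hij, hc, hV, rfl⟩ := h
  have hj : φ (V j) = c * φ (V i) := by rw [hV, map_smul, smul_eq_mul]
  refine Finset.card_pos.2 ?_
  by_cases h : φ (V i) ≤ 0
  · exact ⟨i, by simp [h]⟩
  · refine ⟨j, ?_⟩
    have : φ (V j) < 0 := by rw [hj]; exact mul_neg_of_neg_of_pos hc (not_le.1 h)
    simp [this.le]

lemma finAP_rk {V : κ → U} {P : Finset κ} (h : finAP V P) : sgRk V P ≤ 1 := by
  obtain ⟨i, j, c, hij, hc, hV, rfl⟩ := h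
  have h1 : sgSp V {i, j} ≤ Submodule.span ℝ {V i} := by
    refine sgSp_le fun x hx => ?_
    simp only [Finset.mem_insert, Finset.mem_singleton] at hx
    rcases hx with rfl | rfl
    · exact Submodule.mem_span_singleton_self _
    · rw [hV]; exact Submodule.smul_mem _ _ (Submodule.mem_span_singleton_self _)
  exact (Submodule.finrank_mono h1).trans (by
    have h := finrank_span_finset_le_card (R := ℝ) ({V i} : Finset U)
    rw [Finset.coe_singleton, Finset.card_singleton] at h
    exact h)

lemma finAP_cg [Nontrivial U] {V : κ → U} (h0 : ∀ i, V i ≠ 0) {P : Finset κ}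
    (h : finAP V P) : codegStar (subfam V P) = 1 := by
  apply le_antisymm
  · obtain ⟨χ, hχ⟩ := fin_generic V h0 0
    have hne : χ ≠ 0 := by
      rintro rfl
      obtain ⟨i, j, c, hij, -⟩ := h
      exact (hχ i).1 rfl
    refine (fin_cg_le _ hne).trans ?_
    rw [fin_np_sub, finAP_one h χ fun i => (hχ i).1]
  · obtain ⟨φ, -, h2⟩ := fin_cg_ex (subfam V P)
    rw [← h2, fin_np_sub]
    exact finAP_ge h φ

/-- Structure of the pairs. -/
structure finPairs (V : κ → U) (Ps : Finset (Finset κ)) : Prop where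
  ap : ∀ P ∈ Ps, finAP V P
  dj : ∀ P ∈ Ps, ∀ Q ∈ Ps, P ≠ Q → Disjoint P Q

lemma finPairs_exists (V : κ → U) : ∃ Ps, finPairs V Ps ∧
    ∀ i j : κ, ∀ c : ℝ, i ≠ j → c < 0 → V j = c • V i →
      i ∉ Ps.biUnion id → j ∉ Ps.biUnion id → False := by
  obtain ⟨Ps, hPs, hmax⟩ := Finset.exists_max_image
    ((Finset.univ : Finset (Finset (Finset κ))).filter fun Ps => finPairs V Ps) Finset.card
    ⟨∅, by simp only [Finset.mem_filter, Finset.mem_univ, true_and]; exact ⟨by simp, by simp⟩⟩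
  simp only [Finset.mem_filter, Finset.mem_univ, true_and] at hPs hmax
  refine ⟨Ps, hPs, fun i j c hij hc hV hi hj => ?_⟩
  simp only [Finset.mem_biUnion, id, not_exists, not_and] at hi hj
  have hnew : ∀ P ∈ Ps, Disjoint ({i, j} : Finset κ) P := by
    intro P hP
    rw [Finset.disjoint_left]
    intro x hx
    simp only [Finset.mem_insert, Finset.mem_singleton] at hx
    rcases hx with rfl | rfl
    · exact hi P hP
    · exact hj P hP
  have hnot : ({i, j} : Finset κ) ∉ Ps := fun h => hi _ h (by simp)
  have h2 := hmax (insert {i, j} Ps) ⟨?_, ?_⟩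
  · rw [Finset.card_insert_of_notMem hnot] at h2
    omega
  · intro P hP
    rcases Finset.mem_insert.1 hP with rfl | hP
    · exact ⟨i, j, c, hij, hc, hV, rfl⟩
    · exact hPs.ap P hP
  · intro P hP Q hQ hne
    rcases Finset.mem_insert.1 hP with rfl | hP <;> rcases Finset.mem_insert.1 hQ with rfl | hQ
    · exact absurd rfl hne
    · exact hnew Q hQ
    · exact (hnew P hP).symm
    · exact hPs.dj P hP Q hQ hne

lemma finPairs_pd {V : κ → U} {Ps : Finset (Finset κ)} (h : finPairs V Ps) :
    (Ps : Set (Finset κ)).PairwiseDisjoint id := fun P hP Q hQ hne => h.dj P hP Q hQ hne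

/-- Sums split over pairs and rest. -/
lemma finPairs_sum {M : Type*} [AddCommMonoid M] {V : κ → U} {Ps : Finset (Finset κ)}
    (h : finPairs V Ps) (g : κ → M) :
    ∑ i, g i = (∑ P ∈ Ps, ∑ i ∈ P, g i) + ∑ i ∈ (Ps.biUnion id)ᶜ, g i := by
  rw [← Finset.sum_add_sum_compl (Ps.biUnion id), Finset.sum_biUnion (finPairs_pd h)]
  rfl

lemma finPairs_sgn {V : κ → U} {Ps : Finset (Finset κ)}
    (h : finPairs V Ps) (φ : U →ₗ[ℝ] ℝ) :
    fin_sgn V φ Finset.univ = fin_sgn V φ (Ps.biUnion id)ᶜ := by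
  unfold fin_sgn
  rw [finPairs_sum h, Finset.sum_eq_zero, zero_add]
  exact fun P hP => finAP_sgn (h.ap P hP) φ

lemma finPairs_np {V : κ → U} {Ps : Finset (Finset κ)}
    (h : finPairs V Ps) (φ : U →ₗ[ℝ] ℝ) :
    nonposCount φ V = (∑ P ∈ Ps, (P.filter fun i => φ (V i) ≤ 0).card) +
      ((Ps.biUnion id)ᶜ.filter fun i => φ (V i) ≤ 0).card := by
  unfold nonposCount
  simp only [Finset.card_filter]
  exact finPairs_sum h _

lemma finPairs_cg [Nontrivial U] [Nonempty κ] {V : κ → U} (h0 : ∀ i, V i ≠ 0)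
    {Ps : Finset (Finset κ)} (h : finPairs V Ps) :
    codegStar V = Ps.card + codegStar (subfam V (Ps.biUnion id)ᶜ) := by
  apply le_antisymm
  · obtain ⟨φ, -, hφ⟩ := fin_cg_ex (subfam V (Ps.biUnion id)ᶜ)
    obtain ⟨χ, hχ⟩ := fin_generic V h0 φ
    have hne : χ ≠ 0 := by
      rintro rfl
      exact (hχ (Classical.arbitrary κ)).1 rfl
    refine (fin_cg_le V hne).trans ?_
    rw [finPairs_np h, ← hφ, fin_np_sub,
      Finset.sum_congr rfl fun P hP => finAP_one (h.ap P hP) χ fun i => (hχ i).1]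
    simp only [Finset.sum_const, smul_eq_mul, mul_one]
    refine Nat.add_le_add_left (Finset.card_le_card ?_) _
    intro i hi
    rw [Finset.mem_filter] at hi ⊢
    refine ⟨hi.1, ?_⟩
    by_contra hlt
    exact absurd ((hχ i).2 (not_le.1 hlt)) (not_lt.2 hi.2)
  · obtain ⟨φ, hne, hφ⟩ := fin_cg_ex V
    rw [← hφ, finPairs_np h]
    refine Nat.add_le_add ?_ ?_
    · have := Finset.card_nsmul_le_sum Ps (fun P => (P.filter fun i => φ (V i) ≤ 0).card) 1
        fun P hP => finAP_ge (h.ap P hP) φ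
      simpa using this
    · rw [← fin_np_sub]
      exact fin_cg_le _ hne

lemma fin_rk_biUnion {V : κ → U} (Ps : Finset (Finset κ)) (h : ∀ P ∈ Ps, finAP V P) :
    sgRk V (Ps.biUnion id) ≤ Ps.card := by
  induction Ps using Finset.induction_on with
  | empty => simp [sgRk_empty]
  | insert P Q hP ih =>
    rw [Finset.biUnion_insert, Finset.card_insert_of_notMem hP]
    have h1 := sgRk_union_le (f := V) (A := id P) (B := Q.biUnion id)
    have h2 := ih fun P' hP' => h P' (Finset.mem_insert_of_mem hP')
    have h3 : sgRk V (id P) ≤ 1 := finAP_rk (h P (Finset.mem_insert_self _ _))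
    omega

lemma finPairs_rk {V : κ → U} {Ps : Finset (Finset κ)} (h : finPairs V Ps) :
    confRank V ≤ Ps.card + sgRk V (Ps.biUnion id)ᶜ := by
  have h1 := fin_rk_biUnion Ps h.ap
  have h2 := sgRk_union_le (f := V) (A := Ps.biUnion id) (B := (Ps.biUnion id)ᶜ)
  have h3 : confRank V = sgRk V (Ps.biUnion id ∪ (Ps.biUnion id)ᶜ) := by
    rw [Finset.union_compl]
    unfold confRank sgRk sgSp
    rw [Finset.coe_univ, Set.image_univ]
  omega

/-- Discrepancy bound from an elementary set. -/
lemma fin_disc_ge {V : κ → U} (h0 : ∀ i, V i ≠ 0) {R T : Finset κ}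
    (hap : ∀ i ∈ R, ∀ j ∈ R, ∀ c : ℝ, c < 0 → V j = c • V i → False)
    (hT : sgElem V R T) : ∃ φ : U →ₗ[ℝ] ℝ, (T.card : ℤ) ≤ fin_sgn V φ R := by
  obtain ⟨hTR, hli, hel⟩ := hT
  set F := sgSp V T with hF
  obtain ⟨ψ, hψ⟩ := sg_dual hli (fun _ => 1)
  -- generic functional vanishing on F
  obtain ⟨q, hq⟩ := Module.exists_dual_forall_apply_ne_zero (K := ℝ)
    (fun i : {i : κ // V i ∉ F} => F.mkQ (V i.1)) (by
      rintro ⟨i, hi⟩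
      simpa using hi)
  set φ0 : U →ₗ[ℝ] ℝ := q ∘ₗ F.mkQ with hφ0
  have hk : ∀ x ∈ F, φ0 x = 0 := by
    intro x hx
    have : F.mkQ x = 0 := by simpa using hx
    rw [hφ0, LinearMap.comp_apply, this, map_zero]
  have hnk : ∀ i, V i ∉ F → φ0 (V i) ≠ 0 := fun i hi => hq ⟨i, hi⟩
  have hpsi : ∀ i ∈ R, V i ∈ F → 0 < ψ (V i) := by
    intro i hi hiF
    obtain ⟨t, ht, hit⟩ := hel i hi hiF
    obtain ⟨c, hc⟩ := Submodule.mem_span_singleton.1 hit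
    have hc0 : c ≠ 0 := by
      rintro rfl
      exact h0 i (by rw [← hc, zero_smul])
    have hcpos : 0 < c := by
      by_contra hneg
      exact hap t (hTR ht) i hi c (lt_of_le_of_ne (not_lt.1 hneg) hc0) hc.symm
    rw [← hc, map_smul, hψ t ht]
    simpa using hcpos
  have main : ∀ φ1 : U →ₗ[ℝ] ℝ, (∀ x ∈ F, φ1 x = 0) → (∀ i, V i ∉ F → φ1 (V i) ≠ 0) →
      0 ≤ fin_sgn V φ1 (R.filter fun i => V i ∉ F) →
      ∃ φ : U →ₗ[ℝ] ℝ, (T.card : ℤ) ≤ fin_sgn V φ R := by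
    intro φ1 h1 h2 h3
    obtain ⟨χ, hχ⟩ := fin_perturb V φ1 ψ
    refine ⟨χ, ?_⟩
    have e1 : fin_sgn V χ R = fin_sgn V χ (R.filter fun i => V i ∈ F) +
        fin_sgn V χ (R.filter fun i => V i ∉ F) :=
      (Finset.sum_filter_add_sum_filter_not R _ _).symm
    have e2 : fin_sgn V χ (R.filter fun i => V i ∉ F) =
        fin_sgn V φ1 (R.filter fun i => V i ∉ F) := by
      refine Finset.sum_congr rfl fun i hi => ?_
      have := h2 i (Finset.mem_filter.1 hi).2
      rcases lt_or_gt_of_ne this with h | h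
      · rw [sign_neg h, sign_neg ((hχ i).2.1 h)]
      · rw [sign_pos h, sign_pos ((hχ i).1 h)]
    have e3 : fin_sgn V χ (R.filter fun i => V i ∈ F) =
        ((R.filter fun i => V i ∈ F).card : ℤ) := by
      unfold fin_sgn
      rw [Finset.sum_congr rfl (g := fun _ => (1 : ℤ))]
      · simp
      · intro i hi
        obtain ⟨hi1, hi2⟩ := Finset.mem_filter.1 hi
        rw [sign_pos ((hχ i).2.2.1 (h1 _ hi2) (hpsi i hi1 hi2))]
        simp
    have e4 : T.card ≤ (R.filter fun i => V i ∈ F).card := by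
      refine Finset.card_le_card fun t ht => ?_
      exact Finset.mem_filter.2 ⟨hTR ht, sgSp_mem ht⟩
    omega
  by_cases hs : 0 ≤ fin_sgn V φ0 (R.filter fun i => V i ∉ F)
  · exact main φ0 hk hnk hs
  · refine main (-φ0) (fun x hx => by simp [hk x hx]) (fun i hi => by simpa using hnk i hi) ?_
    have : fin_sgn V (-φ0) (R.filter fun i => V i ∉ F) =
        - fin_sgn V φ0 (R.filter fun i => V i ∉ F) := by
      unfold fin_sgn
      rw [← Finset.sum_neg_distrib]
      refine Finset.sum_congr rfl fun i _ => ?_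
      rw [LinearMap.neg_apply, Left.sign_neg]
      simp
    omega

/-- Assembly of a decomposition from a set of parts. -/
lemma fin_assemble {V : κ → U} (Q : Finset (Finset κ)) (S0 : Finset κ)
    (hd : ∀ A ∈ Q, ∀ B ∈ Q, A ≠ B → Disjoint A B) (hd0 : ∀ A ∈ Q, Disjoint S0 A)
    (hcov : ∀ x, x ∈ S0 ∨ ∃ A ∈ Q, x ∈ A) (h1 : ∀ A ∈ Q, 1 ≤ codegStar (subfam V A))
    (hsum : codegStar V = ∑ A ∈ Q, codegStar (subfam V A)) :
    ∃ S : Fin (Q.card + 1) → Finset κ, IsCodegDecomp V Q.card S := by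
  let e := Q.equivFin
  let g : Fin Q.card → Finset κ := fun i => (e.symm i).1
  have hg : ∀ i, g i ∈ Q := fun i => (e.symm i).2
  have hginj : ∀ i j, i ≠ j → g i ≠ g j := fun i j hij h =>
    hij (e.symm.injective (Subtype.ext h))
  refine ⟨Fin.cons S0 g, ?_, ?_, ?_, ?_⟩
  · intro i j
    refine Fin.cases ?_ (fun i => ?_) i <;> refine Fin.cases ?_ (fun j => ?_) j
    · intro h; exact absurd rfl h
    · intro _; simpa using hd0 _ (hg j)
    · intro _; simpa using (hd0 _ (hg i)).symm
    · intro h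
      simp only [Fin.cons_succ]
      exact hd _ (hg i) _ (hg j) (hginj i j fun h' => h (by rw [h']))
  · intro x
    rcases hcov x with h | ⟨A, hA, hx⟩
    · exact ⟨0, by simpa using h⟩
    · refine ⟨(e ⟨A, hA⟩).succ, ?_⟩
      simpa [g] using hx
  · intro i
    refine Fin.cases ?_ (fun i => ?_) i
    · intro h; exact absurd rfl h
    · intro _
      rw [Fin.cons_succ]
      exact h1 _ (hg i)
  · rw [hsum]
    have hE : (Finset.univ.erase (0 : Fin (Q.card + 1))) =
        Finset.univ.map (Fin.succEmb Q.card) := by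
      ext x
      refine Fin.cases ?_ (fun i => ?_) x
      · simp [Fin.succ_ne_zero]
      · simp [Fin.succ_ne_zero]
    rw [hE, Finset.sum_map]
    simp only [Fin.coe_succEmb]
    rw [← Finset.sum_coe_sort Q, ← Equiv.sum_comp e.symm]
    rfl

lemma fin_main (hE : 1 ≤ Module.finrank ℝ U)
    (V : κ → U) (hirr : ∀ i, V i ≠ 0) (hV : 0 < disc V) :
    ∃ (m : ℕ) (S : Fin (m + 1) → Finset κ),
      IsCodegDecomp V m S ∧ (confRank V : ℤ) + 1 - 2 * (disc V : ℤ) ≤ (m : ℤ) := by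
  have hnt : Nontrivial U := Module.nontrivial_of_finrank_pos (R := ℝ) hE
  have hne : Nonempty κ := by
    by_contra h
    rw [not_nonempty_iff] at h
    have : disc V = 0 := by
      unfold disc posCount negCount
      simp
    omega
  obtain ⟨Ps, hPs, hmax⟩ := finPairs_exists V
  set R := (Ps.biUnion id)ᶜ with hR
  have hcg := finPairs_cg hirr hPs
  have hrk := finPairs_rk hPs
  rw [← hR] at hcg hrk
  have hRd : ∀ P ∈ Ps, Disjoint R P := by
    intro P hP
    rw [Finset.disjoint_left]
    intro x hx hxP
    rw [hR, Finset.mem_compl] at hx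
    exact hx (Finset.mem_biUnion.2 ⟨P, hP, hxP⟩)
  have hcov : ∀ x, x ∈ R ∨ ∃ A ∈ Ps, x ∈ A := by
    intro x
    by_cases hx : x ∈ R
    · exact Or.inl hx
    · rw [hR, Finset.mem_compl, not_not, Finset.mem_biUnion] at hx
      exact Or.inr hx
  by_cases hc : codegStar (subfam V R) = 0
  · obtain ⟨S, hS⟩ := fin_assemble (V := V) Ps R hPs.dj hRd hcov
      (fun A hA => (finAP_cg hirr (hPs.ap A hA)).ge) (by
        rw [hcg, hc, Finset.sum_congr rfl fun A hA => finAP_cg hirr (hPs.ap A hA)]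
        simp)
    refine ⟨_, S, hS, ?_⟩
    obtain ⟨φ, -, hφ⟩ := fin_cg_ex (subfam V R)
    rw [hc, fin_np_sub, Finset.card_eq_zero] at hφ
    have hpos : ∀ i ∈ R, 0 < φ (V i) := by
      intro i hi
      by_contra hle
      have : i ∈ R.filter fun i => φ (V i) ≤ 0 := Finset.mem_filter.2 ⟨hi, not_lt.1 hle⟩
      rw [hφ] at this
      simp at this
    have h1 := fin_sgn_le_disc V φ
    rw [finPairs_sgn hPs, ← hR] at h1
    have h2 : fin_sgn V φ R = (R.card : ℤ) := by
      unfold fin_sgn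
      rw [Finset.sum_congr rfl (g := fun _ => (1 : ℤ))]
      · simp
      · intro i hi
        rw [sign_pos (hpos i hi)]
        simp
    have h3 := sgRk_le_card (f := V) (A := R)
    omega
  · have hRn : R ∉ Ps := by
      intro h
      have h1 := hRd R h
      rw [disjoint_self] at h1
      obtain ⟨i, j, c, -, -, -, h2⟩ := hPs.ap R h
      have : i ∈ R := by rw [h2]; simp
      rw [h1] at this
      simp at this
    obtain ⟨S, hS⟩ := fin_assemble (V := V) (insert R Ps) ∅ (by
        intro A hA B hB hAB
        rcases Finset.mem_insert.1 hA with rfl | hA <;>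
          rcases Finset.mem_insert.1 hB with rfl | hB
        · exact absurd rfl hAB
        · exact hRd B hB
        · exact (hRd A hA).symm
        · exact hPs.dj A hA B hB hAB) (by simp) (by
        intro x
        right
        rcases hcov x with h | ⟨A, hA, hx⟩
        · exact ⟨R, Finset.mem_insert_self _ _, h⟩
        · exact ⟨A, Finset.mem_insert_of_mem hA, hx⟩) (by
        intro A hA
        rcases Finset.mem_insert.1 hA with rfl | hA
        · omega
        · exact (finAP_cg hirr (hPs.ap A hA)).ge) (by
        rw [Finset.sum_insert hRn, hcg,
          Finset.sum_congr rfl fun A hA => finAP_cg hirr (hPs.ap A hA)]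
        simp [add_comm])
    refine ⟨_, S, hS, ?_⟩
    rw [Finset.card_insert_of_notMem hRn]
    obtain ⟨T, hT, hT2⟩ := sg_elementary V _ R (fun i _ => hirr i) rfl
    obtain ⟨φ, hφ⟩ := fin_disc_ge hirr (R := R) (T := T) (by
      intro i hi j hj c hc' hVj
      refine hmax i j c ?_ hc' hVj (Finset.mem_compl.1 hi) (Finset.mem_compl.1 hj)
      rintro rfl
      have : (1 - c) • V i = 0 := by rw [sub_smul, one_smul, ← hVj, sub_self]
      rcases smul_eq_zero.1 this with h | h
      · linarith
      · exact hirr i h) hT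
    have h1 := fin_sgn_le_disc V φ
    rw [finPairs_sgn hPs, ← hR] at h1
    push_cast
    omega

end Final

end SylvesterGallai

/-- an irreducible configuration of rank `r` with `disc V > 0` admits a
codegree* decomposition of length `m ≥ r + 1 − 2·disc V` (as integers). -/
theorem codegree_decomposition_of_pos_disc {E : Type*} [AddCommGroup E] [Module ℝ E]
    [FiniteDimensional ℝ E] (hE : 1 ≤ Module.finrank ℝ E)
    {ι : Type*} [Fintype ι] (V : ι → E) (hirr : ∀ i, V i ≠ 0) (hV : 0 < disc V) :
    ∃ (m : ℕ) (S : Fin (m + 1) → Finset ι),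
      IsCodegDecomp V m S ∧ (confRank V : ℤ) + 1 - 2 * (disc V : ℤ) ≤ (m : ℤ) := by
  exact fin_main hE V hirr hV

end
end

section
/- Let V be an irreducible vector configuration of rank r with n elements in a finite-dimensional real vector space E with dim E ≥ 1, set δ = deg*(V), and suppose n = 2r + 2δ − 1. Then V admits a codegree* decomposition of length at least r − 1. -/
open scoped Classical

noncomputable section

variable {E : Type*} [AddCommGroup E] [Module ℝ E] {ι : Type*} [Fintype ι]

/-- Perturb a functional slightly by a generic functional. -/
lemma aux_perturb (V : ι → E) (φ ψ : E →ₗ[ℝ] ℝ) (hψ : ∀ i, ψ (V i) ≠ 0) :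
    ∃ θ : E →ₗ[ℝ] ℝ, (∀ i, θ (V i) ≠ 0) ∧ (∀ i, 0 < φ (V i) → 0 < θ (V i)) ∧
      (∀ i, φ (V i) = 0 → 0 < ψ (V i) → 0 < θ (V i)) := by
  have h1 : ∀ᶠ ε in nhdsWithin (0 : ℝ) (Set.Ioi 0),
      ∀ i, φ (V i) ≠ 0 → ε * |ψ (V i)| < |φ (V i)| := by
    rw [Filter.eventually_all]
    intro i
    by_cases h : φ (V i) = 0
    · simp [h]
    · have hc : Filter.Tendsto (fun ε : ℝ => ε * |ψ (V i)|) (nhds 0) (nhds (0 * |ψ (V i)|)) :=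
        (continuous_id.mul continuous_const).tendsto 0
      have h2 : ∀ᶠ ε in nhds (0 : ℝ), ε * |ψ (V i)| < |φ (V i)| := by
        apply hc.eventually_lt_const
        simpa using h
      filter_upwards [nhdsWithin_le_nhds h2] with ε hε _ using hε
  obtain ⟨ε, hε, hpos⟩ := (h1.and self_mem_nhdsWithin).exists
  have hpos : 0 < ε := hpos
  have habs : ∀ i, |ε * ψ (V i)| = ε * |ψ (V i)| := fun i => by
    rw [abs_mul, abs_of_pos hpos]
  refine ⟨φ + ε • ψ, ?_, ?_, ?_⟩
  · intro i h
    simp only [LinearMap.add_apply, LinearMap.smul_apply, smul_eq_mul] at h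
    by_cases h0 : φ (V i) = 0
    · rw [h0, zero_add] at h
      exact (mul_ne_zero hpos.ne' (hψ i)) h
    · have := hε i h0
      rw [← habs, show ε * ψ (V i) = - φ (V i) by linarith, abs_neg] at this
      exact lt_irrefl _ this
  · intro i h
    have := hε i h.ne'
    rw [← habs, abs_of_pos h] at this
    have := (abs_lt.1 this).1
    simp only [LinearMap.add_apply, LinearMap.smul_apply, smul_eq_mul]
    linarith
  · intro i h h'
    simp only [LinearMap.add_apply, LinearMap.smul_apply, smul_eq_mul, h, zero_add]
    positivity

/-- The key counting lemma. -/
lemma aux_key [FiniteDimensional ℝ E] (V : ι → E) (hirr : ∀ i, V i ≠ 0) (S : Finset ι) (j : ℕ)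
    (hS : S.card = 2 * j + 1)
    (H : ∀ θ : E →ₗ[ℝ] ℝ, (∀ i, θ (V i) ≠ 0) → (S.filter fun i => 0 < θ (V i)).card ≤ j + 1)
    (φ ψ : E →ₗ[ℝ] ℝ) (hψ : ∀ i ∈ S, φ (V i) = 0 → 0 < ψ (V i)) :
    (S.filter fun i => φ (V i) = 0).card ≤ 1 := by
  obtain ⟨g, hg⟩ := Module.exists_dual_forall_apply_ne_zero (K := ℝ) V hirr
  obtain ⟨ψ', h1, h2, -⟩ := aux_perturb V ψ g hg
  obtain ⟨θ, a1, a2, a3⟩ := aux_perturb V φ ψ' h1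
  obtain ⟨η, b1, b2, b3⟩ := aux_perturb V (-φ) ψ' h1
  have hA := H θ a1
  have hB := H η b1
  have hA' : (S.filter fun i => 0 ≤ φ (V i)).card ≤ j + 1 := by
    refine le_trans (Finset.card_le_card ?_) hA
    intro i hi
    rw [Finset.mem_filter] at hi ⊢
    refine ⟨hi.1, ?_⟩
    rcases hi.2.lt_or_eq with h | h
    · exact a2 i h
    · exact a3 i h.symm (h2 i (hψ i hi.1 h.symm))
  have hB' : (S.filter fun i => φ (V i) ≤ 0).card ≤ j + 1 := by
    refine le_trans (Finset.card_le_card ?_) hB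
    intro i hi
    rw [Finset.mem_filter] at hi ⊢
    refine ⟨hi.1, ?_⟩
    rcases hi.2.lt_or_eq with h | h
    · exact b2 i (by simpa using h)
    · exact b3 i (by simpa using h) (h2 i (hψ i hi.1 h))
  have hu : (S.filter fun i => 0 ≤ φ (V i)) ∪ (S.filter fun i => φ (V i) ≤ 0) = S := by
    ext i
    simp only [Finset.mem_union, Finset.mem_filter]
    have := le_total 0 (φ (V i))
    tauto
  have hi : (S.filter fun i => 0 ≤ φ (V i)) ∩ (S.filter fun i => φ (V i) ≤ 0)
      = S.filter fun i => φ (V i) = 0 := by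
    ext i
    simp only [Finset.mem_inter, Finset.mem_filter, le_antisymm_iff]
    tauto
  have := Finset.card_union_add_card_inter (S.filter fun i => 0 ≤ φ (V i))
    (S.filter fun i => φ (V i) ≤ 0)
  rw [hu, hi] at this
  omega

/-- A functional vanishing on exactly those `V i` in a subspace `W`. -/
lemma aux_zero [FiniteDimensional ℝ E] (V : ι → E) (W : Submodule ℝ E) :
    ∃ φ : E →ₗ[ℝ] ℝ, (∀ x ∈ W, φ x = 0) ∧ ∀ i, φ (V i) = 0 → V i ∈ W := by
  obtain ⟨f, hf⟩ := Module.exists_dual_forall_apply_ne_zero (K := ℝ)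
    (fun i : {i // V i ∉ W} => W.mkQ (V i.1)) (by
      intro i h
      exact i.2 (by simpa using h))
  refine ⟨f.comp W.mkQ, ?_, ?_⟩
  · intro x hx
    have : W.mkQ x = 0 := by simpa using hx
    rw [LinearMap.comp_apply, this, map_zero]
  · intro i h
    by_contra hi
    exact hf ⟨i, hi⟩ h

/-- Sylvester–Gallai, Kelly's proof. -/
lemma aux_sg {F : Type*} [NormedAddCommGroup F] [InnerProductSpace ℝ F] {κ : Type*}
    (p : κ → F) (S : Finset κ) (hinj : ∀ i ∈ S, ∀ j ∈ S, p i = p j → i = j)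
    (h : ∀ i ∈ S, ∀ j ∈ S, i ≠ j → ∃ k ∈ S, k ≠ i ∧ k ≠ j ∧ ∃ t : ℝ, p k = p i + t • (p j - p i)) :
    ∀ i ∈ S, ∀ j ∈ S, i ≠ j → ∀ k ∈ S, ∃ t : ℝ, p k = p i + t • (p j - p i) := by
  by_contra hcon
  push Not at hcon
  obtain ⟨i0, hi0, j0, hj0, hij0, k0, hk0, ht0⟩ := hcon
  let D : κ × κ × κ → ℝ := fun x => ‖p x.2.2 - p x.1‖ ^ 2 -
    (inner ℝ (p x.2.2 - p x.1) (p x.2.1 - p x.1)) ^ 2 / ‖p x.2.1 - p x.1‖ ^ 2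
  let A : Finset (κ × κ × κ) := (S ×ˢ S ×ˢ S).filter fun x =>
    x.1 ≠ x.2.1 ∧ ∀ t : ℝ, p x.2.2 ≠ p x.1 + t • (p x.2.1 - p x.1)
  have hA : A.Nonempty := ⟨(i0, j0, k0), by simp [A, hi0, hj0, hk0, hij0]; exact ht0⟩
  obtain ⟨⟨a, b, c⟩, hmem, hmin⟩ := A.exists_min_image D hA
  simp only [A, Finset.mem_filter, Finset.mem_product] at hmem
  obtain ⟨⟨ha, hb, hc⟩, hab, hline⟩ := hmem
  obtain ⟨d, hd, hda, hdb, t, ht⟩ := h a ha b hb hab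
  set e := p b - p a with he
  have he0 : e ≠ 0 := fun h0 => hab (hinj a ha b hb (sub_eq_zero.1 h0).symm)
  have hE : 0 < ‖e‖ ^ 2 := by positivity
  set τ : ℝ := inner ℝ (p c - p a) e / ‖e‖ ^ 2 with hτ
  set q := p a + τ • e with hq
  set w := p c - q with hw
  have hw0 : w ≠ 0 := fun h0 => hline τ (by rw [← sub_eq_zero]; exact h0)
  have hH : 0 < ‖w‖ ^ 2 := by positivity
  have hca : p c - p a = w + τ • e := by rw [hw, hq]; abel
  have hwe : inner ℝ w e = 0 := by
    have : inner ℝ (p c - p a) e = inner ℝ w e + τ * ‖e‖ ^ 2 := by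
      rw [hca, inner_add_left, real_inner_smul_left, real_inner_self_eq_norm_sq]
    have h3 : τ * ‖e‖ ^ 2 = inner ℝ (p c - p a) e := by
      rw [hτ]; field_simp
    linarith
  have hDabc : D (a, b, c) = ‖w‖ ^ 2 := by
    have h4 : ‖w + τ • e‖ ^ 2 = ‖w‖ ^ 2 + τ ^ 2 * ‖e‖ ^ 2 := by
      rw [norm_add_sq_real, real_inner_smul_right, hwe, norm_smul, mul_pow, Real.norm_eq_abs,
        sq_abs]
      ring
    simp only [D]
    rw [← he, hca, h4, inner_add_left, real_inner_smul_left, real_inner_self_eq_norm_sq, hwe]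
    field_simp
    ring
  -- points on the line with parameters
  have main : ∀ x ∈ S, ∀ y ∈ S, ∀ s u : ℝ, p x = q + s • e → p y = q + u • e →
      0 ≤ s * u → s ^ 2 < u ^ 2 → False := by
    intro x hx y hy s u hxs hyu hsu hlt
    have hcy : p c - p y = w - u • e := by rw [hyu, hw]; abel
    have hxy : p x - p y = (s - u) • e := by rw [hyu, hxs, sub_smul]; abel
    have hsune : s - u ≠ 0 := by
      intro h0
      rw [sub_eq_zero.1 h0] at hlt
      exact lt_irrefl _ hlt
    have hP : ‖w - u • e‖ ^ 2 = ‖w‖ ^ 2 + u ^ 2 * ‖e‖ ^ 2 := by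
      rw [norm_sub_sq_real, real_inner_smul_right, hwe, norm_smul, mul_pow, Real.norm_eq_abs,
        sq_abs]
      ring
    have hPpos : 0 < ‖w‖ ^ 2 + u ^ 2 * ‖e‖ ^ 2 := by positivity
    have hin : (y, c, x) ∈ A := by
      simp only [A, Finset.mem_filter, Finset.mem_product]
      refine ⟨⟨hy, hc, hx⟩, ?_, ?_⟩
      · rintro rfl
        have : w = u • e := by rw [hw, hyu]; abel
        rw [this, real_inner_smul_left, real_inner_self_eq_norm_sq] at hwe
        have hu0 : u = 0 := by
          rcases mul_eq_zero.1 hwe with h | h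
          · exact h
          · exact absurd h hE.ne'
        rw [hu0, zero_smul] at this
        exact hw0 this
      · intro v hv
        have h5 : (s - u) • e = v • (w - u • e) := by
          rw [← hxy, ← hcy, hv]; abel
        have h6 := congrArg (fun z => inner ℝ w z) h5
        simp only [inner_smul_right, inner_sub_right, hwe, real_inner_self_eq_norm_sq] at h6
        have hv0 : v = 0 := by
          have : v * ‖w‖ ^ 2 = 0 := by linarith
          rcases mul_eq_zero.1 this with h | h
          · exact h
          · exact absurd h hH.ne'
        rw [hv0, zero_smul] at h5
        rcases smul_eq_zero.1 h5 with h | h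
        · exact hsune h
        · exact he0 h
    have hle := hmin _ hin
    rw [hDabc] at hle
    have hval : D (y, c, x) = (s - u) ^ 2 * ‖e‖ ^ 2 * ‖w‖ ^ 2 / (‖w‖ ^ 2 + u ^ 2 * ‖e‖ ^ 2) := by
      simp only [D]
      rw [hcy, hxy, hP, norm_smul, mul_pow, Real.norm_eq_abs, sq_abs, real_inner_smul_left,
        inner_sub_right, real_inner_comm, hwe, real_inner_smul_right, real_inner_self_eq_norm_sq]
      field_simp
      ring
    rw [hval, le_div_iff₀ hPpos] at hle
    have hss : s ^ 2 ≤ s * u := by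
      rcases le_total 0 s with h0 | h0
      · rcases h0.lt_or_eq with h0 | h0
        · have hu : 0 ≤ u := nonneg_of_mul_nonneg_right hsu h0
          nlinarith [abs_lt_of_sq_lt_sq hlt hu, le_abs_self s]
        · simp [← h0]
      · rcases h0.lt_or_eq with h0 | h0
        · have hu : u ≤ 0 := by
            by_contra hcon
            push Not at hcon
            nlinarith
          have := abs_lt_of_sq_lt_sq (by simpa using hlt : s ^ 2 < (-u) ^ 2) (by linarith)
          nlinarith [neg_abs_le s]
        · simp [h0]
    have h7 : (s - u) ^ 2 ≤ u ^ 2 := by nlinarith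
    have h8 : (s - u) ^ 2 * ‖e‖ ^ 2 ≤ u ^ 2 * ‖e‖ ^ 2 := mul_le_mul_of_nonneg_right h7 hE.le
    nlinarith [mul_le_mul_of_nonneg_right h8 hH.le, mul_pos hH hH]
  have main2 : ∀ x ∈ S, ∀ y ∈ S, x ≠ y → ∀ s u : ℝ, p x = q + s • e → p y = q + u • e →
      s * u < 0 := by
    intro x hx y hy hne s u hxs hyu
    by_contra hcon
    push Not at hcon
    rcases lt_trichotomy (s ^ 2) (u ^ 2) with h1 | h1 | h1
    · exact main x hx y hy s u hxs hyu hcon h1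
    · apply hne
      apply hinj x hx y hy
      have : s = u := by
        rcases sq_eq_sq_iff_eq_or_eq_neg.1 h1 with h | h
        · exact h
        · subst h
          nlinarith [sq_nonneg u]
      rw [hxs, hyu, this]
    · exact main y hy x hx u s hyu hxs (by linarith [mul_comm s u]) h1
  have pa : p a = q + (-τ) • e := by rw [hq, neg_smul]; abel
  have pb : p b = q + (1 - τ) • e := by rw [hq, sub_smul, one_smul, he]; abel
  have pd : p d = q + (t - τ) • e := by rw [hq, sub_smul, ht]; abel
  have m1 := main2 a ha b hb hab _ _ pa pb
  have m2 := main2 a ha d hd hda.symm _ _ pa pd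
  have m3 := main2 b hb d hd hdb.symm _ _ pb pd
  nlinarith [mul_pos_of_neg_of_neg m1 m2, mul_pos_of_neg_of_neg m1 m3, sq_nonneg (τ),
    mul_pos (mul_pos_of_neg_of_neg m1 m2) (neg_pos.2 m3), sq_nonneg (τ * (1 - τ) * (t - τ))]

lemma aux_rank [FiniteDimensional ℝ E] (V : ι → E) (hirr : ∀ i, V i ≠ 0) (S : Finset ι) (j : ℕ)
    (hS : S.card = 2 * j + 1)
    (H : ∀ θ : E →ₗ[ℝ] ℝ, (∀ i, θ (V i) ≠ 0) → (S.filter fun i => 0 < θ (V i)).card ≤ j + 1)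
    (hanti : ∀ i ∈ S, ∀ k ∈ S, ∀ c : ℝ, c < 0 → V k ≠ c • V i) :
    Module.finrank ℝ (Submodule.span ℝ (V '' (S : Set ι))) ≤ 2 := by
  -- no parallel elements
  have hpar : ∀ i ∈ S, ∀ k ∈ S, i ≠ k → ∀ c : ℝ, V k ≠ c • V i := by
    intro i hi k hk hik c hc
    obtain ⟨φ, h1, h2⟩ := aux_zero V (Submodule.span ℝ {V i})
    obtain ⟨g, hg⟩ := Module.exists_dual_forall_apply_ne_zero (K := ℝ) V hirr
    have := aux_key V hirr S j hS H φ ((g (V i))⁻¹ • g) (by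
      intro l hl hl0
      obtain ⟨c, hc⟩ := Submodule.mem_span_singleton.1 (h2 l hl0)
      have hcne : c ≠ 0 := by
        rintro rfl
        exact hirr l (by rw [← hc, zero_smul])
      have hcpos : 0 < c := by
        by_contra hcon
        exact hanti i hi l hl c (lt_of_le_of_ne (not_lt.1 hcon) hcne) hc.symm
      rw [← hc, LinearMap.smul_apply, map_smul, smul_eq_mul, smul_eq_mul]
      have := hg i
      field_simp
      exact hcpos)
    have hik' : i = k := by
      apply Finset.card_le_one.1 this
      · rw [Finset.mem_filter]
        exact ⟨hi, h1 _ (Submodule.mem_span_singleton_self _)⟩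
      · rw [Finset.mem_filter]
        exact ⟨hk, h1 _ (Submodule.mem_span_singleton.2 ⟨c, hc.symm⟩)⟩
    exact hik hik'
  -- third element on each line
  have hthird : ∀ i ∈ S, ∀ k ∈ S, i ≠ k → ∃ l ∈ S, l ≠ i ∧ l ≠ k ∧
      V l ∈ Submodule.span ℝ {V i, V k} := by
    intro i hi k hk hik
    by_contra hcon
    push Not at hcon
    obtain ⟨φ, h1, h2⟩ := aux_zero V (Submodule.span ℝ {V i, V k})
    obtain ⟨f, hf1, hf2⟩ := Submodule.exists_le_ker_of_notMem (K := ℝ)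
      (p := Submodule.span ℝ {V i}) (v := V k) (fun hm => by
        obtain ⟨c, hc⟩ := Submodule.mem_span_singleton.1 hm
        exact hpar i hi k hk hik c hc.symm)
    obtain ⟨g, hg1, hg2⟩ := Submodule.exists_le_ker_of_notMem (K := ℝ)
      (p := Submodule.span ℝ {V k}) (v := V i) (fun hm => by
        obtain ⟨c, hc⟩ := Submodule.mem_span_singleton.1 hm
        exact hpar k hk i hi hik.symm c hc.symm)
    have hf3 : f (V i) = 0 := hf2 (Submodule.mem_span_singleton_self _)
    have hg3 : g (V k) = 0 := hg2 (Submodule.mem_span_singleton_self _)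
    have := aux_key V hirr S j hS H φ ((g (V i))⁻¹ • g + (f (V k))⁻¹ • f) (by
      intro l hl hl0
      by_cases hli : l = i
      · subst hli; simp [hf3, hg1]
      by_cases hlk : l = k
      · subst hlk; simp [hg3, hf1]
      exact absurd (h2 l hl0) (hcon l hl hli hlk))
    apply hik
    apply Finset.card_le_one.1 this
    · rw [Finset.mem_filter]
      exact ⟨hi, h1 _ (Submodule.subset_span (by simp))⟩
    · rw [Finset.mem_filter]
      exact ⟨hk, h1 _ (Submodule.subset_span (by simp))⟩
  obtain ⟨g, hg⟩ := Module.exists_dual_forall_apply_ne_zero (K := ℝ) V hirr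
  let Φ : E ≃ₗ[ℝ] EuclideanSpace ℝ (Fin (Module.finrank ℝ E)) :=
    LinearEquiv.ofFinrankEq _ _ (by simp)
  let p : ι → EuclideanSpace ℝ (Fin (Module.finrank ℝ E)) := fun i => Φ ((g (V i))⁻¹ • V i)
  have hpV : ∀ i k l : ι, ∀ t : ℝ, p l = p i + t • (p k - p i) ↔
      (g (V l))⁻¹ • V l = (g (V i))⁻¹ • V i + t • ((g (V k))⁻¹ • V k - (g (V i))⁻¹ • V i) := by
    intro i k l t
    simp only [p]
    rw [← map_sub, ← map_smul Φ t, ← map_add, Φ.injective.eq_iff]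
  have hsg := aux_sg p S (by
    intro i hi k hk hik
    by_contra hne
    have h1 := Φ.injective hik
    apply hpar i hi k hk hne (g (V k) * (g (V i))⁻¹)
    rw [mul_smul, h1, smul_smul, mul_inv_cancel₀ (hg k), one_smul]) (by
    intro i hi k hk hik
    obtain ⟨l, hl, hli, hlk, hmem⟩ := hthird i hi k hk hik
    refine ⟨l, hl, hli, hlk, ?_⟩
    obtain ⟨a, b, hab⟩ := Submodule.mem_span_pair.1 hmem
    refine ⟨(g (V l))⁻¹ * b * g (V k), ?_⟩
    rw [hpV]
    have hgl : g (V l) = a * g (V i) + b * g (V k) := by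
      rw [← hab]; simp
    have h0 := hg l
    have h1 := hg i
    have h2 := hg k
    rw [← hab]
    rw [← hab] at h0 hgl
    set G := g (a • V i + b • V k)
    match_scalars
    · field_simp
      rw [hgl]; ring
    · field_simp)
  by_cases hcard : S.card ≤ 1
  · have h3 : ((V '' (S : Set ι)).ncard) ≤ 2 := by
      refine le_trans (Set.ncard_image_le S.finite_toSet) ?_
      rw [Set.ncard_coe_finset]; omega
    have h4 : (V '' (S : Set ι)) = ((S.image V : Finset E) : Set E) := by simp
    rw [h4]
    refine le_trans (finrank_span_finset_le_card _) ?_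
    exact le_trans Finset.card_image_le (by omega)
  · push Not at hcard
    obtain ⟨i, hi, k, hk, hik⟩ := Finset.one_lt_card.1 hcard
    have hle : Submodule.span ℝ (V '' (S : Set ι)) ≤
        Submodule.span ℝ (({V i, V k} : Finset E) : Set E) := by
      rw [Submodule.span_le]
      rintro _ ⟨l, hl, rfl⟩
      obtain ⟨t, ht⟩ := hsg i hi k hk hik l hl
      rw [hpV] at ht
      have : V l = g (V l) • ((g (V l))⁻¹ • V l) := by
        rw [smul_smul, mul_inv_cancel₀ (hg l), one_smul]
      rw [this, ht]
      have mi : V i ∈ Submodule.span ℝ (({V i, V k} : Finset E) : Set E) :=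
        Submodule.subset_span (by simp)
      have mk : V k ∈ Submodule.span ℝ (({V i, V k} : Finset E) : Set E) :=
        Submodule.subset_span (by simp)
      exact Submodule.smul_mem _ _ (Submodule.add_mem _ (Submodule.smul_mem _ _ mi)
        (Submodule.smul_mem _ _ (Submodule.sub_mem _ (Submodule.smul_mem _ _ mk)
          (Submodule.smul_mem _ _ mi))))
    refine le_trans (Submodule.finrank_mono hle) ?_
    exact le_trans (finrank_span_finset_le_card _) Finset.card_le_two

lemma aux_codeg [FiniteDimensional ℝ E] {κ : Type*} [Fintype κ] [Nonempty κ] (V : ι → E)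
    (hirr : ∀ i, V i ≠ 0) (f : κ → ι) (c : ℕ)
    (h1 : ∀ θ : E →ₗ[ℝ] ℝ, (∀ i, θ (V i) ≠ 0) →
      c ≤ (Finset.univ.filter fun k => θ (V (f k)) < 0).card)
    (h2 : ∃ θ : E →ₗ[ℝ] ℝ, (∀ i, θ (V i) ≠ 0) ∧
      (Finset.univ.filter fun k => θ (V (f k)) < 0).card = c) :
    codegStar (fun k => V (f k)) = c := by
  obtain ⟨θ, hθ, hc⟩ := h2
  let k0 : κ := Classical.arbitrary κ
  have hnt : Nontrivial E := ⟨V (f k0), 0, hirr _⟩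
  unfold codegStar
  rw [if_pos hnt]
  apply le_antisymm
  · apply Nat.sInf_le
    refine ⟨θ, ?_, ?_⟩
    · rintro rfl
      exact hθ (f k0) rfl
    · rw [← hc]
      unfold nonposCount
      congr 1
      ext k
      simp only [Finset.mem_filter]
      have := hθ (f k)
      rw [(this.le_iff_lt : θ (V (f k)) ≤ 0 ↔ _)]
  · apply le_csInf
    · exact ⟨_, θ, by rintro rfl; exact hθ (f k0) rfl, rfl⟩
    · rintro _ ⟨φ, -, rfl⟩
      obtain ⟨η, e1, e2, -⟩ := aux_perturb V φ θ hθ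
      refine le_trans (h1 η e1) (Finset.card_le_card ?_)
      intro k hk
      rw [Finset.mem_filter] at hk ⊢
      refine ⟨hk.1, ?_⟩
      by_contra hcon
      exact lt_asymm hk.2 (e2 _ (not_le.1 hcon))

lemma aux_filter_card (S : Finset ι) (P : ι → Prop) :
    (Finset.univ.filter fun k : {i // i ∈ S} => P k.1).card = (S.filter P).card := by
  rw [← Finset.card_map (Function.Embedding.subtype (fun i => i ∈ S))]
  congr 1
  ext i
  simp only [Finset.mem_map, Finset.mem_filter, Finset.mem_univ, true_and,
    Function.Embedding.coe_subtype, Subtype.exists, exists_and_left, exists_prop]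
  constructor
  · rintro ⟨a, h1, h2, rfl⟩
    exact ⟨h2, h1⟩
  · rintro ⟨h1, h2⟩
    exact ⟨i, h2, h1, rfl⟩

lemma aux_neg_card (V : ι → E) (S : Finset ι) (θ : E →ₗ[ℝ] ℝ) (hθ : ∀ i, θ (V i) ≠ 0) :
    (S.filter fun i => 0 < θ (V i)).card + (S.filter fun i => θ (V i) < 0).card = S.card := by
  rw [← Finset.card_filter_add_card_filter_not (s := S) (fun i => 0 < θ (V i))]
  congr 2
  ext i
  simp only [Finset.mem_filter, not_lt]
  rw [((hθ i).le_iff_lt : θ (V i) ≤ 0 ↔ _)]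

lemma aux_codeg_S [FiniteDimensional ℝ E] (V : ι → E) (hirr : ∀ i, V i ≠ 0) (S : Finset ι) (j : ℕ)
    (hS : S.card = 2 * j + 1)
    (H : ∀ θ : E →ₗ[ℝ] ℝ, (∀ i, θ (V i) ≠ 0) → (S.filter fun i => 0 < θ (V i)).card ≤ j + 1)
    {κ : Type*} [Fintype κ] (f : κ → ι)
    (hf : ∀ P : ι → Prop, (Finset.univ.filter fun k => P (f k)).card = (S.filter P).card) :
    codegStar (fun k => V (f k)) = j := by
  have hne : Nonempty κ := by
    have := hf (fun _ => True)
    simp only [Finset.filter_true, hS, Finset.card_univ] at this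
    exact Fintype.card_pos_iff.1 (by omega)
  apply aux_codeg V hirr f
  · intro θ hθ
    rw [hf (fun i => θ (V i) < 0)]
    have := aux_neg_card V S θ hθ
    have := H θ hθ
    omega
  · obtain ⟨g, hg⟩ := Module.exists_dual_forall_apply_ne_zero (K := ℝ) V hirr
    have hg' : ∀ i, (-g) (V i) ≠ 0 := fun i => by simpa using hg i
    have e1 := aux_neg_card V S g hg
    have e2 := aux_neg_card V S (-g) hg'
    have e3 := H g hg
    have e4 := H (-g) hg'
    have e5 : (S.filter fun i => (-g) (V i) < 0).card = (S.filter fun i => 0 < g (V i)).card := by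
      simp
    by_cases h : (S.filter fun i => g (V i) < 0).card = j
    · exact ⟨g, hg, by rw [hf (fun i => g (V i) < 0)]; exact h⟩
    · exact ⟨-g, hg', by rw [hf (fun i => (-g) (V i) < 0)]; omega⟩

lemma aux_pair_pos (V : ι → E) (i k : ι) (c : ℝ) (hc : c < 0) (hik : V k = c • V i)
    (hne : i ≠ k) (θ : E →ₗ[ℝ] ℝ) (hθ : ∀ i, θ (V i) ≠ 0) :
    (({i, k} : Finset ι).filter fun i => 0 < θ (V i)).card = 1 := by
  have h1 : θ (V k) = c * θ (V i) := by rw [hik, map_smul, smul_eq_mul]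
  rcases lt_or_gt_of_ne (hθ i) with h | h
  · have h2 : 0 < θ (V k) := by rw [h1]; exact mul_pos_of_neg_of_neg hc h
    rw [Finset.filter_insert, if_neg (not_lt.2 h.le), Finset.filter_singleton, if_pos h2]
    simp
  · have h2 : θ (V k) < 0 := by rw [h1]; exact mul_neg_of_neg_of_pos hc h
    rw [Finset.filter_insert, if_pos h, Finset.filter_singleton, if_neg (not_lt.2 h2.le)]
    simp

lemma aux_codeg_pair [FiniteDimensional ℝ E] (V : ι → E) (hirr : ∀ i, V i ≠ 0) (i k : ι) (c : ℝ)
    (hc : c < 0) (hik : V k = c • V i) (hne : i ≠ k) :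
    codegStar (subfam V {i, k}) = 1 := by
  have : Nonempty {l // l ∈ ({i, k} : Finset ι)} := ⟨⟨i, by simp⟩⟩
  have key : ∀ θ : E →ₗ[ℝ] ℝ, (∀ i, θ (V i) ≠ 0) →
      (Finset.univ.filter fun l : {l // l ∈ ({i, k} : Finset ι)} => θ (V l.1) < 0).card = 1 := by
    intro θ hθ
    rw [aux_filter_card {i, k} (fun l => θ (V l) < 0)]
    have e1 := aux_neg_card V {i, k} θ hθ
    rw [aux_pair_pos V i k c hc hik hne θ hθ, Finset.card_pair hne] at e1
    omega
  obtain ⟨g, hg⟩ := Module.exists_dual_forall_apply_ne_zero (K := ℝ) V hirr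
  exact aux_codeg V hirr (fun l : {l // l ∈ ({i, k} : Finset ι)} => l.1) 1
    (fun θ hθ => (key θ hθ).ge) ⟨g, hg, key g hg⟩

lemma aux_decomp [FiniteDimensional ℝ E] (V : ι → E) (hirr : ∀ i, V i ≠ 0) (j : ℕ) :
    ∀ S : Finset ι, S.card = 2 * j + 1 →
    (∀ θ : E →ₗ[ℝ] ℝ, (∀ i, θ (V i) ≠ 0) → (S.filter fun i => 0 < θ (V i)).card ≤ j + 1) →
    ∃ (m : ℕ) (T : Fin m → Finset ι), (∀ a b, a ≠ b → Disjoint (T a) (T b)) ∧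
      (∀ a, T a ⊆ S) ∧ (∀ a, 1 ≤ codegStar (subfam V (T a))) ∧
      ∑ a, codegStar (subfam V (T a)) = j ∧
      Module.finrank ℝ (Submodule.span ℝ (V '' (S : Set ι))) ≤ m + 1 := by
  induction j with
  | zero =>
    intro S hS H
    refine ⟨0, Fin.elim0, fun a => a.elim0, fun a => a.elim0, fun a => a.elim0, by simp, ?_⟩
    have h4 : (V '' (S : Set ι)) = ((S.image V : Finset E) : Set E) := by simp
    rw [h4]
    refine le_trans (finrank_span_finset_le_card _) ?_
    exact le_trans Finset.card_image_le (by omega)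
  | succ j ih =>
    intro S hS H
    by_cases hanti : ∀ i ∈ S, ∀ k ∈ S, ∀ c : ℝ, c < 0 → V k ≠ c • V i
    · have hr := aux_rank V hirr S (j + 1) hS H hanti
      have hc : codegStar (subfam V S) = j + 1 :=
        aux_codeg_S V hirr S (j + 1) hS H (fun l : {l // l ∈ S} => l.1) (aux_filter_card S)
      refine ⟨1, fun _ => S, ?_, fun _ => subset_rfl, fun _ => by rw [hc]; omega, by simp [hc], hr⟩
      intro a b hab
      exact absurd (Subsingleton.elim a b) hab
    · push Not at hanti
      obtain ⟨i, hi, k, hk, c, hc, hik⟩ := hanti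
      have hne : i ≠ k := by
        rintro rfl
        have h1 : (1 - c) • V i = 0 := by rw [sub_smul, one_smul, ← hik, sub_self]
        rcases smul_eq_zero.1 h1 with h | h
        · linarith
        · exact hirr i h
      have hsub : ({i, k} : Finset ι) ⊆ S := by
        intro l hl
        simp only [Finset.mem_insert, Finset.mem_singleton] at hl
        rcases hl with rfl | rfl <;> assumption
      obtain ⟨m, T, t1, t2, t3, t4, t5⟩ := ih (S \ {i, k}) (by
        rw [Finset.card_sdiff_of_subset hsub, Finset.card_pair hne]; omega) (by
        intro θ hθ
        have e1 := H θ hθ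
        have e2 := aux_pair_pos V i k c hc hik hne θ hθ
        have e3 : (S.filter fun i => 0 < θ (V i)).card =
            ((S \ {i, k}).filter fun i => 0 < θ (V i)).card +
            (({i, k} : Finset ι).filter fun i => 0 < θ (V i)).card := by
          rw [← Finset.card_union_of_disjoint
            (Finset.disjoint_filter_filter Finset.sdiff_disjoint), ← Finset.filter_union,
            Finset.sdiff_union_of_subset hsub]
        omega)
      have hcp := aux_codeg_pair V hirr i k c hc hik hne
      have hdis : ∀ a, Disjoint ({i, k} : Finset ι) (T a) := fun a =>
        Finset.disjoint_of_subset_right (t2 a) Finset.disjoint_sdiff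
      refine ⟨m + 1, Fin.cons {i, k} T, ?_, ?_, ?_, ?_, ?_⟩
      · intro a b
        refine Fin.cases ?_ (fun a => ?_) a <;> refine Fin.cases ?_ (fun b => ?_) b
        · simp
        · intro _
          simpa only [Fin.cons_zero, Fin.cons_succ] using hdis b
        · intro _
          simpa only [Fin.cons_zero, Fin.cons_succ] using (hdis a).symm
        · intro hab
          simpa only [Fin.cons_succ] using t1 a b (fun h => hab (by rw [h]))
      · intro a
        refine Fin.cases ?_ (fun a => ?_) a
        · simpa only [Fin.cons_zero] using hsub
        · simpa only [Fin.cons_succ] using (t2 a).trans Finset.sdiff_subset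
      · intro a
        refine Fin.cases ?_ (fun a => ?_) a
        · rw [Fin.cons_zero, hcp]
        · rw [Fin.cons_succ]; exact t3 a
      · rw [Fin.sum_univ_succ]
        change codegStar (subfam V {i, k}) + ∑ a, codegStar (subfam V (T a)) = j + 1
        rw [hcp, t4]; omega
      · have hle : Submodule.span ℝ (V '' (S : Set ι)) ≤
            Submodule.span ℝ (V '' ((S \ {i, k} : Finset ι) : Set ι)) ⊔ Submodule.span ℝ {V i} := by
          rw [Submodule.span_le]
          rintro _ ⟨l, hl, rfl⟩
          by_cases hl' : l ∈ ({i, k} : Finset ι)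
          · apply Submodule.mem_sup_right
            simp only [Finset.mem_insert, Finset.mem_singleton] at hl'
            rcases hl' with rfl | rfl
            · exact Submodule.mem_span_singleton_self _
            · exact Submodule.mem_span_singleton.2 ⟨c, hik.symm⟩
          · apply Submodule.mem_sup_left
            exact Submodule.subset_span ⟨l, by simpa using ⟨hl, by simpa using hl'⟩, rfl⟩
        have h1 := Submodule.finrank_mono hle
        have h2 := Submodule.finrank_add_le_finrank_add_finrank
          (Submodule.span ℝ (V '' ((S \ {i, k} : Finset ι) : Set ι))) (Submodule.span ℝ {V i})
        have h3 := finrank_span_singleton (K := ℝ) (hirr i)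
        omega

/-- an irreducible configuration of rank `r` with `n = 2r + 2δ − 1`
elements (`δ = deg* V`) admits a codegree* decomposition of length at least `r − 1`. -/
theorem codegree_decomposition_of_almost_extremal {E : Type*} [AddCommGroup E]
    [Module ℝ E] [FiniteDimensional ℝ E] (hE : 1 ≤ Module.finrank ℝ E)
    {n : ℕ} (V : Fin n → E) (hirr : ∀ i, V i ≠ 0)
    (hn : (n : ℤ) = 2 * (confRank V : ℤ) + 2 * degStar V - 1) :
    ∃ (m : ℕ) (S : Fin (m + 1) → Finset (Fin n)),
      IsCodegDecomp V m S ∧ (confRank V : ℤ) - 1 ≤ (m : ℤ) := by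
  have hnt : Nontrivial E := Module.nontrivial_of_finrank_pos (R := ℝ) (by omega)
  set A : Set ℕ := {k | ∃ φ : E →ₗ[ℝ] ℝ, φ ≠ 0 ∧ posCount φ V = k} with hA
  have hbdd : BddAbove A := by
    refine ⟨n, ?_⟩
    rintro _ ⟨φ, -, rfl⟩
    unfold posCount
    exact le_trans (Finset.card_le_univ _) (by simp)
  have hM : (n : ℤ) = 2 * (sSup A : ℕ) - 1 := by
    rw [hn]; unfold degStar; ring
  obtain ⟨j, hj⟩ : ∃ j, sSup A = j + 1 := ⟨sSup A - 1, by omega⟩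
  have hnj : n = 2 * j + 1 := by omega
  have hcard : (Finset.univ : Finset (Fin n)).card = 2 * j + 1 := by simpa using hnj
  have H : ∀ θ : E →ₗ[ℝ] ℝ, (∀ i, θ (V i) ≠ 0) →
      ((Finset.univ : Finset (Fin n)).filter fun i => 0 < θ (V i)).card ≤ j + 1 := by
    intro θ hθ
    rw [← hj]
    refine le_csSup hbdd ⟨θ, ?_, rfl⟩
    rintro rfl
    exact hθ ⟨0, by omega⟩ rfl
  obtain ⟨m, T, t1, t2, t3, t4, t5⟩ := aux_decomp V hirr j Finset.univ hcard H
  have hV : codegStar V = j :=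
    aux_codeg_S V hirr Finset.univ j hcard H (fun l : Fin n => l) (fun P => rfl)
  refine ⟨m, Fin.cons (Finset.univ \ Finset.univ.biUnion T) T, ⟨?_, ?_, ?_, ?_⟩, ?_⟩
  · have hdis : ∀ a, Disjoint (Finset.univ \ Finset.univ.biUnion T) (T a) := fun a =>
      Finset.disjoint_of_subset_right
        (Finset.subset_biUnion_of_mem T (Finset.mem_univ a)) Finset.sdiff_disjoint
    intro a b
    refine Fin.cases ?_ (fun a => ?_) a <;> refine Fin.cases ?_ (fun b => ?_) b
    · simp
    · intro _
      simpa only [Fin.cons_zero, Fin.cons_succ] using hdis b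
    · intro _
      simpa only [Fin.cons_zero, Fin.cons_succ] using (hdis a).symm
    · intro hab
      simpa only [Fin.cons_succ] using t1 a b (fun h => hab (by rw [h]))
  · intro x
    by_cases hx : x ∈ Finset.univ.biUnion T
    · obtain ⟨a, -, ha⟩ := Finset.mem_biUnion.1 hx
      exact ⟨a.succ, by rw [Fin.cons_succ]; exact ha⟩
    · exact ⟨0, by rw [Fin.cons_zero, Finset.mem_sdiff]; exact ⟨Finset.mem_univ _, hx⟩⟩
  · intro a
    refine Fin.cases ?_ (fun a => ?_) a
    · intro h; exact absurd rfl h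
    · intro _
      rw [Fin.cons_succ]; exact t3 a
  · rw [hV]
    have h1 := Finset.add_sum_erase Finset.univ (fun a : Fin (m + 1) => codegStar (subfam V
      ((Fin.cons (Finset.univ \ Finset.univ.biUnion T) T : Fin (m + 1) → Finset (Fin n)) a)))
      (Finset.mem_univ 0)
    rw [Fin.sum_univ_succ] at h1
    have h2 := Nat.add_left_cancel h1
    rw [h2]
    exact t4.symm
  · have : confRank V = Module.finrank ℝ
        (Submodule.span ℝ (V '' ((Finset.univ : Finset (Fin n)) : Set (Fin n)))) := by
      unfold confRank
      rw [Finset.coe_univ, Set.image_univ]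
    omega

end
end
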